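/- arXiv:0910.0267 — 5 statements merged into one kernel-verified Lean document; each statement's English description precedes it below -/
import Mathlib

section
/- Let G = A ∗_C B be a nontrivial amalgamated free product (A ≠ C and B ≠ C) and let N be a normal subgroup of G. If N is finitely generated and N is not contained in C, then the subgroup NC generated by N and C has finite index in G. -/
namespace SimpleGraph

variable {V : Type*} {Γ : SimpleGraph V}

theorem IsAcyclic.edges_subset_of_isPath (hΓ : Γ.IsAcyclic) {u v : V} {p : Γ.Walk u v}
    (hp : p.IsPath) (w : Γ.Walk u v) : p.edges ⊆ w.edges := by
  classical
  have h := congrArg Subtype.val ((hΓ.subsingleton_path u v).elim ⟨p, hp⟩ w.toPath)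
  simp only [Walk.toPath] at h
  rw [h]
  exact w.edges_bypass_subset_edges

theorem IsAcyclic.eq_of_adj_of_adj (hΓ : Γ.IsAcyclic) {u v v' w : V} (huw : u ≠ w)
    (huv : Γ.Adj u v) (hvw : Γ.Adj v w) (huv' : Γ.Adj u v') (hvw' : Γ.Adj v' w) : v = v' := by
  have hp : (Walk.cons huv (.cons hvw .nil)).IsPath := by
    simp [huv.ne, hvw.ne, huw]
  have := hΓ.edges_subset_of_isPath hp (.cons huv' (.cons hvw' .nil))
  have h := this (show s(u, v) ∈ _ by simp)
  simp only [Walk.edges_cons, Walk.edges_nil, List.mem_cons, List.not_mem_nil, or_false,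
    Sym2.eq_iff] at h
  have := huv.ne
  have := huv'.ne
  tauto

theorem IsAcyclic.reachable_inf (hΓ : Γ.IsAcyclic) {Γ₁ Γ₂ : SimpleGraph V} (h₁ : Γ₁ ≤ Γ)
    (h₂ : Γ₂ ≤ Γ) {u v : V} (h₁r : Γ₁.Reachable u v) (h₂r : Γ₂.Reachable u v) :
    (Γ₁ ⊓ Γ₂).Reachable u v := by
  obtain ⟨p, hp⟩ := h₁r.exists_isPath
  obtain ⟨q⟩ := h₂r
  have hsub := hΓ.edges_subset_of_isPath (hp.mapLe h₁) (q.mapLe h₂)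
  simp only [Walk.edges_mapLe_eq_edges] at hsub
  refine ⟨p.transfer _ fun e he => ?_⟩
  rw [edgeSet_inf]
  exact ⟨p.edges_subset_edgeSet he, q.edges_subset_edgeSet (hsub he)⟩

theorem Walk.exists_isPath_support_inter_eq_start {u v : V} (p : Γ.Walk u v) (hp : p.IsPath)
    {S : Set V} (hS : ∃ x ∈ p.support, x ∈ S) :
    ∃ x ∈ S, ∃ q : Γ.Walk x v, q.IsPath ∧ ∀ y ∈ q.support, y ∈ S → y = x := by
  induction p with
  | @nil u =>
    obtain ⟨x, hx, hxS⟩ := hS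
    obtain rfl : x = u := by simpa using hx
    exact ⟨x, hxS, .nil, .nil, by simp⟩
  | cons h p ih =>
    by_cases hS' : ∃ x ∈ p.support, x ∈ S
    · exact ih hp.of_cons hS'
    · push Not at hS'
      obtain ⟨x, hx, hxS⟩ := hS
      rw [support_cons, List.mem_cons] at hx
      rcases hx with rfl | hx
      · refine ⟨_, hxS, .cons h p, hp, fun y hy hyS => ?_⟩
        rw [support_cons, List.mem_cons] at hy
        exact hy.resolve_right fun hy => hS' y hy hyS
      · exact absurd hxS (hS' x hx)

theorem Walk.mem_of_mem_support {u v x : V} (p : Γ.Walk u v) {S : Set V}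
    (hS : ∀ a b, Γ.Adj a b → a ∈ S → b ∈ S) (hu : u ∈ S) (hx : x ∈ p.support) : x ∈ S := by
  induction p with
  | nil => simpa [show x = _ by simpa using hx] using hu
  | cons h p ih =>
    rw [support_cons, List.mem_cons] at hx
    rcases hx with rfl | hx
    · exact hu
    · exact ih (hS _ _ h hu) hx

/-- In a tree, two disjoint nonempty connected sets that are both invariant under a group action
force a fixed point in the first of them. -/
theorem IsTree.exists_forall_smul_eq {M : Type*} [Group M] [MulAction M V] (hΓ : Γ.IsTree)
    (hM : ∀ (m : M) (u v : V), Γ.Adj u v → Γ.Adj (m • u) (m • v)) {S T : Set V}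
    (hS : S.Nonempty) (hT : T.Nonempty) (hST : Disjoint S T)
    (hSM : ∀ u ∈ S, ∀ m : M, ∃ w : Γ.Walk u (m • u), ∀ x ∈ w.support, x ∈ S)
    (hTM : ∀ u ∈ T, ∀ m : M, ∃ w : Γ.Walk u (m • u), ∀ x ∈ w.support, x ∈ T) :
    ∃ u ∈ S, ∀ m : M, m • u = u := by
  obtain ⟨x, hx⟩ := hS
  obtain ⟨y, hy⟩ := hT
  obtain ⟨p₀, hp₀⟩ := (hΓ.connected.preconnected x y).exists_isPath
  obtain ⟨u, hu, p, hp, hpS⟩ :=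
    p₀.exists_isPath_support_inter_eq_start hp₀ ⟨x, p₀.start_mem_support, hx⟩
  refine ⟨u, hu, fun m => ?_⟩
  obtain ⟨q, hq⟩ := hSM u hu m
  obtain ⟨r, hr⟩ := hTM y hy m
  let f : Γ →g Γ := ⟨(m • ·), fun h => hM m _ _ h⟩
  have hsub := hΓ.isAcyclic.edges_subset_of_isPath hp
    (q.append ((p.map f).append r.reverse))
  cases p with
  | nil => exact (Set.disjoint_left.1 hST hu hy).elim
  | @cons _ v _ h p =>
    have hvS : v ∉ S := fun hv => h.ne (hpS v (by simp) hv).symm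
    have he := hsub (show s(u, v) ∈ (Walk.cons h p).edges by simp)
    rw [Walk.edges_append, Walk.edges_append, List.mem_append, List.mem_append,
      Walk.edges_reverse, List.mem_reverse] at he
    rcases he with he | he | he
    · exact absurd (hq v (q.snd_mem_support_of_mem_edges he)) hvS
    · have hmem := Walk.fst_mem_support_of_mem_edges _ he
      rw [Walk.support_map, List.mem_map] at hmem
      obtain ⟨z, hz, hzu⟩ := hmem
      have hzu' : m • z = u := hzu
      obtain ⟨w, hw⟩ := hSM u hu m⁻¹
      have hzS : z ∈ S := by
        rw [← inv_smul_eq_iff.2 hzu'.symm]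
        exact hw _ w.end_mem_support
      rwa [hpS z hz hzS] at hzu'
    · exact absurd (hr u (r.fst_mem_support_of_mem_edges he)) (Set.disjoint_left.1 hST hu)

end SimpleGraph

section CosetGraph

open SimpleGraph

variable {G : Type*} [Group G] (A B : Subgroup G)

/-- The bipartite graph on the left cosets of `A` and of `B` in which every `g ∈ S` contributes an
edge joining `gA` and `gB`. -/
def cosetGraph (S : Set G) : SimpleGraph ((G ⧸ A) ⊕ (G ⧸ B)) where
  Adj u v := ∃ g ∈ S, (u = .inl ↑g ∧ v = .inr ↑g) ∨ (u = .inr ↑g ∧ v = .inl ↑g)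
  symm := ⟨fun u v ⟨g, hg, h⟩ => ⟨g, hg, by tauto⟩⟩
  loopless := ⟨by rintro u ⟨g, hg, ⟨rfl, h⟩ | ⟨rfl, h⟩⟩ <;> simp at h⟩

variable {A B}

theorem cosetGraph_mono {S T : Set G} (h : S ⊆ T) : cosetGraph A B S ≤ cosetGraph A B T :=
  fun _ _ ⟨g, hg, hadj⟩ => ⟨g, h hg, hadj⟩

theorem cosetGraph_adj_smul {S T : Set G} {g : G} (h : ∀ s ∈ S, g * s ∈ T)
    {u v : (G ⧸ A) ⊕ (G ⧸ B)} (huv : (cosetGraph A B S).Adj u v) :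
    (cosetGraph A B T).Adj (g • u) (g • v) := by
  obtain ⟨s, hs, ⟨rfl, rfl⟩ | ⟨rfl, rfl⟩⟩ := huv
  · exact ⟨g * s, h s hs, .inl ⟨rfl, rfl⟩⟩
  · exact ⟨g * s, h s hs, .inr ⟨rfl, rfl⟩⟩

theorem cosetGraph_reachable_smul {S T : Set G} {g : G} (h : ∀ s ∈ S, g * s ∈ T)
    {u v : (G ⧸ A) ⊕ (G ⧸ B)} (huv : (cosetGraph A B S).Reachable u v) :
    (cosetGraph A B T).Reachable (g • u) (g • v) :=
  huv.map (⟨(g • ·), cosetGraph_adj_smul h⟩ : cosetGraph A B S →g cosetGraph A B T)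

theorem cosetGraph_inf_le {S T : Set G} (hT : ∀ t ∈ T, ∀ c ∈ A ⊓ B, t * c ∈ T) :
    cosetGraph A B S ⊓ cosetGraph A B T ≤ cosetGraph A B (S ∩ T) := by
  have key : ∀ s t : G, t ∈ T → (s : G ⧸ A) = t → (s : G ⧸ B) = t → s ∈ T := by
    intro s t ht hA hB
    simpa using hT t ht (t⁻¹ * s) ⟨QuotientGroup.eq.1 hA.symm, QuotientGroup.eq.1 hB.symm⟩
  rintro u v ⟨⟨s, hs, h⟩, ⟨t, ht, h'⟩⟩
  refine ⟨s, ⟨hs, key s t ht ?_ ?_⟩, h⟩ <;>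
    rcases h with ⟨rfl, rfl⟩ | ⟨rfl, rfl⟩ <;> rcases h' with ⟨h₁, h₂⟩ | ⟨h₁, h₂⟩ <;>
    simp_all

variable (A B) in
/-- The vertices of `cosetGraph A B S` whose `N`-orbit lies in a single connected component. -/
def cosetGraphCore (N : Subgroup G) (S : Set G) : Set ((G ⧸ A) ⊕ (G ⧸ B)) :=
  {u | ∀ n ∈ N, (cosetGraph A B S).Reachable u (n • u)}

theorem mem_cosetGraphCore_of_adj {N : Subgroup G} {S : Set G}
    (hS : ∀ n ∈ N, ∀ s ∈ S, n * s ∈ S) {u v : (G ⧸ A) ⊕ (G ⧸ B)}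
    (huv : (cosetGraph A B S).Adj u v) (hu : u ∈ cosetGraphCore A B N S) :
    v ∈ cosetGraphCore A B N S := fun n hn =>
  huv.reachable.symm.trans <| (hu n hn).trans (cosetGraph_adj_smul (hS n hn) huv).reachable

theorem exists_walk_support_subset_cosetGraphCore {N : Subgroup G} {S : Set G}
    (hS : ∀ n ∈ N, ∀ s ∈ S, n * s ∈ S) {u : (G ⧸ A) ⊕ (G ⧸ B)}
    (hu : u ∈ cosetGraphCore A B N S) {n : G} (hn : n ∈ N) :
    ∃ w : (cosetGraph A B Set.univ).Walk u (n • u), ∀ x ∈ w.support,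
      x ∈ cosetGraphCore A B N S := by
  obtain ⟨w⟩ := hu n hn
  refine ⟨w.mapLe (cosetGraph_mono (Set.subset_univ S)), fun x hx => ?_⟩
  rw [Walk.support_mapLe_eq_support] at hx
  exact w.mem_of_mem_support (fun a b hab ha => mem_cosetGraphCore_of_adj hS hab ha) hu hx

theorem exists_finset_reachable (D : Subgroup G) {u v : (G ⧸ A) ⊕ (G ⧸ B)}
    (h : (cosetGraph A B Set.univ).Reachable u v) :
    ∃ E : Finset (G ⧸ D), (cosetGraph A B {g | (g : G ⧸ D) ∈ E}).Reachable u v := by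
  classical
  obtain ⟨w⟩ := h
  induction w with
  | nil => exact ⟨∅, .rfl⟩
  | cons h w ih =>
    obtain ⟨E, hE⟩ := ih
    obtain ⟨g, -, hg⟩ := h
    refine ⟨insert (g : G ⧸ D) E, Reachable.trans (Adj.reachable ⟨g, by simp, hg⟩)
      (hE.mono (cosetGraph_mono fun x hx => ?_))⟩
    exact Finset.mem_insert_of_mem hx

theorem exists_finset_mem_cosetGraphCore (hconn : (cosetGraph A B Set.univ).Connected)
    {N : Subgroup G} (hN : N.FG) (D : Subgroup G)
    (hD : ∀ n ∈ N, ∀ g : G, ((n * g : G) : G ⧸ D) = g) (u : (G ⧸ A) ⊕ (G ⧸ B)) :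
    ∃ E : Finset (G ⧸ D), u ∈ cosetGraphCore A B N {g | (g : G ⧸ D) ∈ E} := by
  classical
  obtain ⟨F, rfl⟩ := hN
  choose E hE using fun s : G => exists_finset_reachable D (hconn.preconnected u (s • u))
  refine ⟨F.biUnion E, fun n hn => ?_⟩
  have hinv : ∀ n ∈ Subgroup.closure (F : Set G), ∀ s ∈ {g : G | (g : G ⧸ D) ∈ F.biUnion E},
      n * s ∈ {g : G | (g : G ⧸ D) ∈ F.biUnion E} := by
    intro n hn s hs
    rw [Set.mem_ofPred_eq, hD n hn s]
    exact hs
  induction hn using Subgroup.closure_induction with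
  | mem s hs =>
    refine (hE s).mono (cosetGraph_mono fun x hx => ?_)
    exact Finset.mem_biUnion.2 ⟨s, hs, hx⟩
  | one => rw [one_smul]
  | mul x y hx _ ihx ihy =>
    rw [mul_smul]
    exact ihx.trans (cosetGraph_reachable_smul (hinv x hx) ihy)
  | inv x hx ih =>
    simpa using (cosetGraph_reachable_smul (hinv _ (inv_mem hx)) ih).symm

theorem smul_mem_cosetGraphCore {N : Subgroup G} [N.Normal] {S T : Set G} {g : G}
    (h : ∀ s ∈ S, g * s ∈ T) {u : (G ⧸ A) ⊕ (G ⧸ B)} (hu : u ∈ cosetGraphCore A B N S) :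
    g • u ∈ cosetGraphCore A B N T := by
  intro n hn
  have := cosetGraph_reachable_smul h
    (hu (g⁻¹ * n * g) (by simpa using Subgroup.Normal.conj_mem ‹_› n hn g⁻¹))
  simpa [← mul_smul, mul_assoc] using this

theorem inter_cosetGraphCore_subset (hacyc : (cosetGraph A B Set.univ).IsAcyclic)
    {N : Subgroup G} {S T : Set G} (hT : ∀ t ∈ T, ∀ c ∈ A ⊓ B, t * c ∈ T) :
    cosetGraphCore A B N S ∩ cosetGraphCore A B N T ⊆ cosetGraphCore A B N (S ∩ T) :=
  fun _ ⟨hS, hT'⟩ n hn =>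
    (hacyc.reachable_inf (cosetGraph_mono (Set.subset_univ S)) (cosetGraph_mono (Set.subset_univ T))
      (hS n hn) (hT' n hn)).mono (cosetGraph_inf_le hT)

theorem le_right_of_le_left (hacyc : (cosetGraph A B Set.univ).IsAcyclic) (hBA : ¬ B ≤ A)
    {N : Subgroup G} [hN : N.Normal] (hNA : N ≤ A) : N ≤ B := by
  obtain ⟨b, hbB, hbA⟩ := SetLike.not_le_iff_exists.1 hBA
  intro n hn
  have hnb : b⁻¹ * (n * b) ∈ A := hNA (by simpa [mul_assoc] using hN.conj_mem n hn b⁻¹)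
  have := hacyc.eq_of_adj_of_adj (u := .inl ↑(1 : G)) (v := .inr ↑(1 : G)) (v' := .inr ↑n)
    (w := .inl ↑b) (by simpa [QuotientGroup.eq] using hbA) ⟨1, trivial, by simp⟩
    ⟨b, trivial, .inr ⟨by simpa [QuotientGroup.eq] using hbB, rfl⟩⟩
    ⟨n, trivial, .inl ⟨by simpa [QuotientGroup.eq] using hNA hn, rfl⟩⟩
    ⟨n * b, trivial, .inr ⟨by simpa [QuotientGroup.eq] using hbB,
      by simpa [QuotientGroup.eq] using hnb⟩⟩
  simpa [QuotientGroup.eq] using this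

theorem le_left_of_le_right (hacyc : (cosetGraph A B Set.univ).IsAcyclic) (hAB : ¬ A ≤ B)
    {N : Subgroup G} [hN : N.Normal] (hNB : N ≤ B) : N ≤ A := by
  obtain ⟨a, haA, haB⟩ := SetLike.not_le_iff_exists.1 hAB
  intro n hn
  have hna : a⁻¹ * (n * a) ∈ B := hNB (by simpa [mul_assoc] using hN.conj_mem n hn a⁻¹)
  have := hacyc.eq_of_adj_of_adj (u := .inr ↑(1 : G)) (v := .inl ↑(1 : G)) (v' := .inl ↑n)
    (w := .inr ↑a) (by simpa [QuotientGroup.eq] using haB) ⟨1, trivial, by simp⟩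
    ⟨a, trivial, .inl ⟨by simpa [QuotientGroup.eq] using haA, rfl⟩⟩
    ⟨n, trivial, .inr ⟨by simpa [QuotientGroup.eq] using hNB hn, rfl⟩⟩
    ⟨n * a, trivial, .inl ⟨by simpa [QuotientGroup.eq] using haA,
      by simpa [QuotientGroup.eq] using hna⟩⟩
  simpa [QuotientGroup.eq] using this

/-- A normal subgroup fixing a vertex of the coset graph, when the latter is a tree, is contained
in the intersection of the two vertex groups. -/
theorem le_inf_of_forall_smul_eq (hacyc : (cosetGraph A B Set.univ).IsAcyclic) (hAB : ¬ A ≤ B)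
    (hBA : ¬ B ≤ A) {N : Subgroup G} [hN : N.Normal] {u : (G ⧸ A) ⊕ (G ⧸ B)}
    (hu : ∀ n ∈ N, n • u = u) : N ≤ A ⊓ B := by
  have key : ∀ (D : Subgroup G) (g : G), (∀ n ∈ N, n • (g : G ⧸ D) = g) → N ≤ D := by
    intro D g h n hn
    have := h (g * n * g⁻¹) (hN.conj_mem n hn g)
    rw [MulAction.Quotient.smul_coe, eq_comm, QuotientGroup.eq] at this
    simpa [mul_assoc] using this
  rcases u with u | u
  · obtain ⟨g, rfl⟩ := QuotientGroup.mk_surjective u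
    have hNA := key A g fun n hn => Sum.inl_injective (hu n hn)
    exact le_inf hNA (le_right_of_le_left hacyc hBA hNA)
  · obtain ⟨g, rfl⟩ := QuotientGroup.mk_surjective u
    have hNB := key B g fun n hn => Sum.inr_injective (hu n hn)
    exact le_inf (le_left_of_le_right hacyc hAB hNB) hNB

/-- If the coset graph of `A` and `B` is a tree, then a finitely generated normal subgroup not
contained in the edge group `A ⊓ B` generates with it a subgroup of finite index. -/
theorem finiteIndex_sup_of_isTree (hΓ : (cosetGraph A B Set.univ).IsTree) (hAB : ¬ A ≤ B)
    (hBA : ¬ B ≤ A) {N : Subgroup G} [hN : N.Normal] (hfg : N.FG) (hNC : ¬ N ≤ A ⊓ B) :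
    (N ⊔ A ⊓ B).FiniteIndex := by
  classical
  set D := N ⊔ A ⊓ B with hD
  have hND : ∀ n ∈ N, ∀ g : G, ((n * g : G) : G ⧸ D) = g := by
    intro n hn g
    rw [eq_comm, QuotientGroup.eq, ← mul_assoc]
    exact le_sup_left (a := N) (by simpa using hN.conj_mem n hn g⁻¹)
  let edges (E : Finset (G ⧸ D)) : Set G := {g | (g : G ⧸ D) ∈ E}
  have hedges : ∀ E, ∀ n ∈ N, ∀ s ∈ edges E, n * s ∈ edges E := fun E n hn s hs =>
    show ((n * s : G) : G ⧸ D) ∈ E from (hND n hn s).symm ▸ hs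
  have hfix : ¬ ∃ u : (G ⧸ A) ⊕ (G ⧸ B), ∀ n ∈ N, n • u = u := fun ⟨u, hu⟩ =>
    hNC (le_inf_of_forall_smul_eq hΓ.isAcyclic hAB hBA hu)
  obtain ⟨E, ⟨u, hu⟩, hmin⟩ := WellFounded.has_min (wellFounded_lt (α := Finset (G ⧸ D)))
    {E | (cosetGraphCore A B N (edges E)).Nonempty}
    ((exists_finset_mem_cosetGraphCore hΓ.connected hfg D hND (.inl ↑(1 : G))).imp
      fun E hE => ⟨_, hE⟩)
  have hinv : ∀ (g : G), ∀ q ∈ E, g⁻¹ • q ∈ E := by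
    intro g
    let E' := E.image (g • ·)
    have hE' : ∀ s ∈ edges E, g * s ∈ edges E' := fun s hs => Finset.mem_image_of_mem (g • ·) hs
    have hne : (cosetGraphCore A B N (edges E) ∩ cosetGraphCore A B N (edges E')).Nonempty := by
      by_contra h
      rw [← Set.not_disjoint_iff_nonempty_inter, not_not] at h
      obtain ⟨v, -, hv⟩ := hΓ.exists_forall_smul_eq (M := N)
        (fun n _ _ huv => cosetGraph_adj_smul (g := (n : G)) (fun _ _ => Set.mem_univ _) huv)
        ⟨u, hu⟩ ⟨g • u, smul_mem_cosetGraphCore hE' hu⟩ h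
        (fun _ hx n => exists_walk_support_subset_cosetGraphCore (hedges E) hx n.2)
        (fun _ hx n => exists_walk_support_subset_cosetGraphCore (hedges E') hx n.2)
      exact hfix ⟨v, fun n hn => hv ⟨n, hn⟩⟩
    have hinter := hne.mono (inter_cosetGraphCore_subset hΓ.isAcyclic fun t ht c hc => by
      have : ((t * c : G) : G ⧸ D) = t := by
        rw [eq_comm, QuotientGroup.eq]
        exact le_sup_right (a := N) (by simpa using hc)
      exact show ((t * c : G) : G ⧸ D) ∈ E' from this.symm ▸ ht)
    have hle : E ⊆ E' := by
      by_contra hle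
      refine hmin (E ∩ E') ?_ (Finset.inter_subset_left.lt_of_not_ge fun h =>
        hle (h.trans Finset.inter_subset_right))
      have : edges (E ∩ E') = edges E ∩ edges E' := by
        ext x
        simp [edges]
      rwa [Set.mem_ofPred_eq, this]
    intro q hq
    obtain ⟨r, hr, rfl⟩ := Finset.mem_image.1 (hle hq)
    simpa using hr
  have hEne : E.Nonempty := by
    by_contra hE
    rw [Finset.not_nonempty_iff_eq_empty] at hE
    refine hfix ⟨u, fun n hn => ?_⟩
    have h := hu n hn
    have hbot : cosetGraph A B (edges E) = ⊥ := by
      ext x y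
      simp [cosetGraph, edges, hE]
    rw [hbot, reachable_bot] at h
    exact h.symm
  obtain ⟨q, hq⟩ := hEne
  have huniv : ∀ r : G ⧸ D, r ∈ E := by
    intro r
    obtain ⟨g, rfl⟩ := MulAction.exists_smul_eq G q r
    simpa using hinv g⁻¹ q hq
  have : Finite (G ⧸ D) := Finite.of_finite_univ (E.finite_toSet.subset fun r _ => huniv r)
  exact Subgroup.finiteIndex_of_finite_quotient

end CosetGraph

namespace Monoid.PushoutI

open SimpleGraph NormalWord

variable {H : Type*} [Group H]

section NormalWord

variable {ι : Type*} {K : ι → Type*} [∀ i, Group (K i)] {φ : ∀ i, H →* K i}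
  {d : Transversal φ}

/-- The sequence of factors in which the letters of a normal word lie. -/
def NormalWord.indices (w : NormalWord d) : List ι := w.toList.map Sigma.fst

/-- Left multiplication by an element of a factor changes at most the first letter of a normal
word. -/
theorem NormalWord.exists_indices_smul [DecidableEq ι] [∀ i, DecidableEq (K i)] (i : ι) (g : K i)
    (w : NormalWord d) :
    ∃ t : List ι, (w.indices = t ∨ w.indices = i :: t) ∧
      ((of (φ := φ) i g • w).indices = t ∨ (of (φ := φ) i g • w).indices = i :: t) := by
  have key : ∀ p : Pair d i, ((equivPair i).symm p).indices = p.tail.toList.map Sigma.fst ∨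
      ((equivPair i).symm p).indices = i :: p.tail.toList.map Sigma.fst := by
    intro p
    simp only [equivPair, Equiv.coe_fn_symm_mk, rcons, NormalWord.indices,
      CoprodI.Word.equivPair_symm, CoprodI.Word.rcons]
    split_ifs
    · exact .inl rfl
    · exact .inr rfl
  refine ⟨(equivPair i w).tail.toList.map Sigma.fst, ?_, ?_⟩
  · simpa using key (equivPair i w)
  · rw [summand_smul_def]
    exact key { equivPair i w with head := g * (equivPair i w).head }

theorem NormalWord.prod_mem_range_of_indices_eq_nil {w : NormalWord d} (hw : w.indices = []) :
    w.prod ∈ (base φ).range := by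
  have : w.toWord = CoprodI.Word.empty := by
    ext1
    simpa [NormalWord.indices] using hw
  exact ⟨w.head, by simp [NormalWord.prod, this]⟩

end NormalWord

variable {K : Bool → Type*} [∀ i, Group (K i)] {φ : ∀ i, H →* K i}

theorem exists_last_index (hφ : ∀ i, Function.Injective (φ i)) :
    ∃ l : PushoutI φ → Option Bool, l 1 = none ∧ (∀ g, l g = none → g ∈ (base φ).range) ∧
      (∀ g, ∀ a ∈ (of (φ := φ) true).range, l (g * a) = some false ↔ l g = some false) ∧
      (∀ g, ∀ b ∈ (of (φ := φ) false).range, l (g * b) = some true ↔ l g = some true) := by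
  classical
  obtain ⟨d⟩ := transversal_nonempty φ hφ
  have key : ∀ (i j : Bool) (t s s' : List Bool), i ≠ j → (s = t ∨ s = i :: t) →
      (s' = t ∨ s' = i :: t) → (s'.getLast? = some j ↔ s.getLast? = some j) := by
    intro i j t s s' hij hs hs'
    rcases t with _ | ⟨a, t⟩ <;> rcases hs with rfl | rfl <;> rcases hs' with rfl | rfl <;>
      simp [hij]
  have hmul : ∀ (i j : Bool) (g : PushoutI φ) (k : K i), i ≠ j →
      ((((g * of i k)⁻¹ • (empty : NormalWord d)).indices.getLast? = some j) ↔
        (g⁻¹ • (empty : NormalWord d)).indices.getLast? = some j) := by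
    intro i j g k hij
    rw [mul_inv_rev, mul_smul, ← map_inv]
    obtain ⟨t, h, h'⟩ := exists_indices_smul i k⁻¹ (g⁻¹ • (empty : NormalWord d))
    exact key i j t _ _ hij h h'
  refine ⟨fun g => (g⁻¹ • (empty : NormalWord d)).indices.getLast?, ?_, ?_, ?_, ?_⟩
  · simp [indices]
  · intro g hg
    simpa using prod_mem_range_of_indices_eq_nil (List.getLast?_eq_none_iff.1 hg)
  · rintro g _ ⟨a, rfl⟩
    exact hmul true false g a (by decide)
  · rintro g _ ⟨b, rfl⟩
    exact hmul false true g b (by decide)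

theorem cosetGraph_isAcyclic (hφ : ∀ i, Function.Injective (φ i)) :
    (cosetGraph (of (φ := φ) true).range (of (φ := φ) false).range Set.univ).IsAcyclic := by
  obtain ⟨l, hl_one, hl_none, hl_true, hl_false⟩ := exists_last_index hφ
  set A := (of (φ := φ) true).range
  set B := (of (φ := φ) false).range
  have hC : A ⊓ B = (base φ).range := inf_of_range_eq_base_range hφ (by decide)
  let sideA : PushoutI φ ⧸ A → Prop := Quotient.lift (fun g => l g ≠ some false) fun x y hxy => by
    have := hl_true x _ (QuotientGroup.leftRel_apply.1 hxy)
    rw [mul_inv_cancel_left] at this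
    simp [this]
  let sideB : PushoutI φ ⧸ B → Prop := Quotient.lift (fun g => l g = some true) fun x y hxy => by
    have := hl_false x _ (QuotientGroup.leftRel_apply.1 hxy)
    rw [mul_inv_cancel_left] at this
    simp [this]
  let side (u : (PushoutI φ ⧸ A) ⊕ (PushoutI φ ⧸ B)) : Prop := Sum.elim sideA sideB u
  have hside : ∀ g : PushoutI φ, g ∉ A ⊓ B →
      (side (.inl ↑g) ↔ side (.inr ↑g)) := by
    intro g hg
    change l g ≠ some false ↔ l g = some true
    rcases h : l g with _ | _ | _
    · exact absurd (hC ▸ hl_none g h) hg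
    · simp
    · simp
  have hbridge : ∀ g : PushoutI φ, (cosetGraph A B Set.univ).IsBridge s(.inl ↑g, .inr ↑g) := by
    intro g
    rw [isBridge_iff]
    intro hr
    have hconst : ∀ u v, ((cosetGraph A B Set.univ).deleteEdges {s(.inl ↑g, .inr ↑g)}).Reachable u v
        → (side (g⁻¹ • u) ↔ side (g⁻¹ • v)) := by
      rintro u v ⟨w⟩
      induction w with
      | nil => rfl
      | cons h w ih =>
        refine Iff.trans ?_ ih
        rw [deleteEdges_adj] at h
        obtain ⟨⟨s, -, hs⟩, hne⟩ := h
        have hmem : g⁻¹ * s ∉ A ⊓ B := by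
          rintro ⟨hA, hB⟩
          have hA := QuotientGroup.eq.2 hA
          have hB := QuotientGroup.eq.2 hB
          rcases hs with ⟨rfl, rfl⟩ | ⟨rfl, rfl⟩ <;> simp [hA, hB, Sym2.eq_swap] at hne
        rcases hs with ⟨rfl, rfl⟩ | ⟨rfl, rfl⟩
        · exact hside _ hmem
        · exact (hside _ hmem).symm
    have h := hconst _ _ hr
    change l (g⁻¹ * g) ≠ some false ↔ l (g⁻¹ * g) = some true at h
    simp [hl_one] at h
  rw [isAcyclic_iff_forall_adj_isBridge]
  rintro u v ⟨g, -, ⟨rfl, rfl⟩ | ⟨rfl, rfl⟩⟩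
  · exact hbridge g
  · rw [Sym2.eq_swap]
    exact hbridge g

theorem cosetGraph_connected :
    (cosetGraph (of (φ := φ) true).range (of (φ := φ) false).range Set.univ).Connected := by
  set A := (of (φ := φ) true).range with hA
  set B := (of (φ := φ) false).range with hB
  have hadj : ∀ g : PushoutI φ, (cosetGraph A B Set.univ).Adj (.inl ↑g) (.inr ↑g) :=
    fun g => ⟨g, trivial, .inl ⟨rfl, rfl⟩⟩
  have key : ∀ g : PushoutI φ,
      (cosetGraph A B Set.univ).Reachable (.inl ↑(1 : PushoutI φ)) (.inl ↑g) := by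
    intro g
    induction g using PushoutI.induction_on with
    | of i k =>
      cases i with
      | false =>
        have h : ((1 : PushoutI φ) : PushoutI φ ⧸ B) = (of false k : PushoutI φ) := by
          simp [QuotientGroup.eq, hB]
        have h' := (hadj (of false k)).symm
        rw [← h] at h'
        exact (hadj 1).reachable.trans h'.reachable
      | true =>
        have h : ((1 : PushoutI φ) : PushoutI φ ⧸ A) = (of true k : PushoutI φ) := by
          simp [QuotientGroup.eq, hA]
        rw [← h]
    | base h =>
      have h : ((1 : PushoutI φ) : PushoutI φ ⧸ A) = (base φ h : PushoutI φ) := by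
        simp [QuotientGroup.eq, hA, ← of_apply_eq_base φ true]
      rw [← h]
    | mul x y hx hy =>
      have h := cosetGraph_reachable_smul (g := x) (T := Set.univ) (fun _ _ => trivial) hy
      simp only [Sum.smul_inl, MulAction.Quotient.smul_coe, smul_eq_mul, mul_one] at h
      exact hx.trans h
  rw [connected_iff_exists_forall_reachable]
  refine ⟨.inl ↑(1 : PushoutI φ), ?_⟩
  rintro (u | u)
  · obtain ⟨g, rfl⟩ := QuotientGroup.mk_surjective u
    exact key g
  · obtain ⟨g, rfl⟩ := QuotientGroup.mk_surjective u
    exact (key g).trans (hadj g).reachable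

end Monoid.PushoutI

open Monoid

/-- Let `G = A ∗_C B` be a nontrivial amalgamated free product (pushout of the
injective maps `φ true : H →* K true` and `φ false : H →* K false`, with `A`, `B`, `C` the images
of `K true`, `K false`, `H` in `G`) and let `N` be a normal subgroup of `G`.  If `N` is finitely
generated and `N` is not contained in `C`, then the subgroup `N ⊔ C` generated by `N` and `C` has
finite index in `G`. -/
theorem stmt_0 {H : Type*} [Group H] {K : Bool → Type*} [∀ i, Group (K i)]
    (φ : ∀ i, H →* K i) (hφ : ∀ i, Function.Injective (φ i))
    (A B C N : Subgroup (PushoutI φ))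
    (hA : A = (PushoutI.of (φ := φ) true).range)
    (hB : B = (PushoutI.of (φ := φ) false).range)
    (hC : C = (PushoutI.base φ).range)
    (hAC : A ≠ C) (hBC : B ≠ C)
    (hNnorm : N.Normal) (hNfg : N.FG) (hNC : ¬ N ≤ C) :
    (N ⊔ C).FiniteIndex := by
  subst hA hB hC
  have hinf := PushoutI.inf_of_range_eq_base_range hφ (show true ≠ false by decide)
  rw [← hinf] at hAC hBC hNC ⊢
  exact finiteIndex_sup_of_isTree
    ⟨PushoutI.cosetGraph_connected, PushoutI.cosetGraph_isAcyclic hφ⟩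
    (fun h => hAC (inf_eq_left.2 h).symm) (fun h => hBC (inf_eq_right.2 h).symm) hNfg hNC
end

section
/- Let G = A ∗_C B be a nontrivial amalgamated free product (A ≠ C and B ≠ C) and let N be a normal subgroup of G. If N is finitely generated, N is not contained in C, and N ∩ C is finitely generated, then N ∩ A and N ∩ B are finitely generated. -/
open Monoid

/-- Every element of a group generated as a monoid by `Λ` is reached from `1` by a finite walk with
steps in `Λ`, expressed as an induction principle along a finite set of vertices and steps. -/
theorem exists_finite_walk {G : Type*} [Group G] {Λ : Set G} (hΛ : Submonoid.closure Λ = ⊤)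
    (g : G) :
    ∃ P L : Set G, P.Finite ∧ L.Finite ∧ L ⊆ Λ ∧ ∀ (X : Set G) (I : G → Prop) (x : G),
      (∀ p ∈ P, x * p ∈ X) →
      (∀ y ∈ X, ∀ l ∈ L, y * l ∈ X → I y → I (y * l)) → I x → I (x * g) := by
  have hg : g ∈ Submonoid.closure Λ := hΛ ▸ Submonoid.mem_top g
  induction hg using Submonoid.closure_induction with
  | mem g hg =>
    refine ⟨{1, g}, {g}, Set.toFinite _, Set.toFinite _, by simpa using hg, ?_⟩
    intro X I x hP hstep hx
    exact hstep x (by simpa using hP 1 (by simp)) g rfl (hP g (by simp)) hx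
  | one => exact ⟨∅, ∅, Set.finite_empty, Set.finite_empty, Set.empty_subset _, by simp⟩
  | mul a b _ _ iha ihb =>
    obtain ⟨P, L, hP, hL, hLΛ, h⟩ := iha
    obtain ⟨P', L', hP', hL', hLΛ', h'⟩ := ihb
    refine ⟨P ∪ (a * ·) '' P', L ∪ L', hP.union (hP'.image _), hL.union hL',
      Set.union_subset hLΛ hLΛ', ?_⟩
    intro X I x hX hstep hx
    rw [← mul_assoc]
    refine h' X I (x * a) (fun p hp => ?_) (fun y hy l hl => hstep y hy l (.inr hl)) ?_
    · rw [mul_assoc]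
      exact hX _ (.inr ⟨p, hp, rfl⟩)
    · exact h X I x (fun p hp => hX p (.inl hp)) (fun y hy l hl => hstep y hy l (.inl hl)) hx

theorem exists_fg_of_mem_coset {G : Type*} [Group G] {A C N : Subgroup G} (hCA : C ≤ A)
    (hN : N.Normal) (hNC : (N ⊓ C).FG) {w : G} (hw : w ∈ A) (u : G) :
    ∃ K : Subgroup G, K.FG ∧ K ≤ N ⊓ A ∧ ∀ x ∈ N ⊓ A, w⁻¹ * x * u ∈ C → x ∈ K := by
  by_cases h : ∃ d ∈ N ⊓ A, w⁻¹ * d * u ∈ C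
  · obtain ⟨d, hd, hdC⟩ := h
    refine ⟨(N ⊓ C).map (MulAut.conj w).toMonoidHom ⊔ Subgroup.zpowers d,
      .sup ((Subgroup.fg_iff_submonoid_fg _).2 (((Subgroup.fg_iff_submonoid_fg _).1 hNC).map _)) ⟨{d}, by simp [Subgroup.zpowers_eq_closure]⟩, sup_le ?_ ?_, ?_⟩
    · rintro _ ⟨y, hy, rfl⟩
      exact ⟨hN.conj_mem y hy.1 w, A.mul_mem (A.mul_mem hw (hCA hy.2)) (A.inv_mem hw)⟩
    · simpa using hd
    · intro x hx hxC
      have hmem : w⁻¹ * (x * d⁻¹) * w ∈ N ⊓ C := by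
        refine ⟨?_, ?_⟩
        · simpa using hN.conj_mem _ (N.mul_mem hx.1 (N.inv_mem hd.1)) w⁻¹
        · have hw' : w⁻¹ * (x * d⁻¹) * w = w⁻¹ * x * u * (w⁻¹ * d * u)⁻¹ := by group
          exact hw' ▸ C.mul_mem hxC (C.inv_mem hdC)
      have hx' : x = MulAut.conj w (w⁻¹ * (x * d⁻¹) * w) * d := by
        simp only [MulAut.conj_apply]
        group
      rw [hx']
      exact mul_mem (Subgroup.mem_sup_left ⟨_, hmem, rfl⟩)
        (Subgroup.mem_sup_right (Subgroup.mem_zpowers d))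
  · push Not at h
    exact ⟨⊥, ⟨∅, by simp⟩, bot_le, fun x hx hxC => absurd hxC (h x hx)⟩

/-- A criterion for the intersection of a finitely generated normal subgroup `N` with `A` to be
finitely generated. The translates `y * r` with `r ∈ R` play the role of a branch at the vertex
`A` of a tree, which a walk with steps in `Λ` can only leave through the edge `y C`. -/
theorem fg_inf_of_branch {G : Type*} [Group G] {A C N : Subgroup G} {Λ R : Set G} (hCA : C ≤ A)
    (hΛ : Submonoid.closure Λ = ⊤) (hΛR : ∀ l ∈ Λ, l ∈ A ∨ l ∈ R)
    (hRΛ : ∀ r ∈ R, ∀ l ∈ Λ, r * l ∈ R ∨ r * l ∈ C) (hRA : ∀ r ∈ R, r ∉ A)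
    (hN : N.Normal) (hNfg : N.FG) (hNC : (N ⊓ C).FG) : (N ⊓ A).FG := by
  obtain ⟨S, hS⟩ := hNfg
  choose P L hP hL hLΛ hwalk using exists_finite_walk hΛ
  let S' : Set G := S ∪ (S : Set G)⁻¹
  have hS' : S'.Finite := S.finite_toSet.union S.finite_toSet.inv
  let PP : Set G := ⋃ s ∈ S', P s
  let LL : Set G := ⋃ s ∈ S', L s
  have hPP : PP.Finite := hS'.biUnion fun s _ => hP s
  have hLL : LL.Finite := hS'.biUnion fun s _ => hL s
  let X : Set G := {x | ∃ n ∈ N, ∃ p ∈ PP, x = n * p}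
  have hu : ∀ p : G, ∃ u ∈ A, ∀ n ∈ N, n * p ∈ A → n * p * u⁻¹ ∈ N ⊓ A := by
    intro p
    by_cases h : ∃ t ∈ N, t * p ∈ A
    · obtain ⟨t, ht, htp⟩ := h
      refine ⟨t * p, htp, fun n hn hnp => ⟨?_, A.mul_mem hnp (A.inv_mem htp)⟩⟩
      have ht' : n * p * (t * p)⁻¹ = n * t⁻¹ := by group
      exact ht' ▸ N.mul_mem hn (N.inv_mem ht)
    · push Not at h
      exact ⟨1, A.one_mem, fun n hn hnp => absurd hnp (h n hn)⟩
  choose u huA hu using hu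
  let U : Set G := insert 1 (u '' PP)
  have hU : U.Finite := (hPP.image u).insert 1
  have hUA : ∀ v ∈ U, v ∈ A := by
    rintro v (rfl | ⟨p, -, rfl⟩)
    · exact A.one_mem
    · exact huA p
  have hXU : ∀ x ∈ X, x ∈ A → ∃ v ∈ U, x * v⁻¹ ∈ N ⊓ A := by
    rintro _ ⟨n, hn, p, hp, rfl⟩ hx
    exact ⟨u p, .inr ⟨p, hp, rfl⟩, hu p n hn hx⟩
  let W : Set G := {w | w ∈ A ∧ ∃ v ∈ U, ∃ l ∈ insert 1 LL, v * l = w}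
  have hW : W.Finite :=
    (Set.Finite.image2 (· * ·) hU (hLL.insert 1)).subset fun w hw => hw.2
  have hK : ∀ q : W × U, ∃ K : Subgroup G, K.FG ∧ K ≤ N ⊓ A ∧
      ∀ x ∈ N ⊓ A, (q.1 : G)⁻¹ * x * q.2 ∈ C → x ∈ K := fun q =>
    exists_fg_of_mem_coset hCA hN hNC q.1.2.1 _
  choose K hKfg hKle hK using hK
  have := hW.to_subtype
  have := hU.to_subtype
  let H₀ : Subgroup G := ⨆ q, K q
  have hH₀ : H₀ ≤ N ⊓ A := iSup_le hKle
  have hH₀mem : ∀ v ∈ U, ∀ l ∈ insert 1 LL, l ∈ A → ∀ v' ∈ U, ∀ x ∈ N ⊓ A,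
      (v * l)⁻¹ * x * v' ∈ C → x ∈ H₀ := by
    intro v hv l hl hlA v' hv' x hx hxC
    exact (le_iSup K (⟨v * l, A.mul_mem (hUA v hv) hlA, v, hv, l, hl, rfl⟩, ⟨v', hv'⟩))
      (hK _ x hx hxC)
  let V : Set G := {y | ∃ v ∈ U, y * v⁻¹ ∈ H₀}
  have hVA : ∀ y ∈ V, y ∈ A := by
    rintro y ⟨v, hv, hy⟩
    simpa using A.mul_mem (hH₀ hy).2 (hUA v hv)
  have hVstep : ∀ y ∈ V, ∀ l ∈ insert 1 LL, l ∈ A → ∀ x ∈ X, (y * l)⁻¹ * x ∈ C → x ∈ V := by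
    rintro y ⟨v, hv, hy⟩ l hl hlA x hxX hxC
    have hxA : x ∈ A := by
      simpa only [mul_inv_cancel_left] using
        A.mul_mem (A.mul_mem (hVA y ⟨v, hv, hy⟩) hlA) (hCA hxC)
    obtain ⟨v', hv', hx⟩ := hXU x hxX hxA
    refine ⟨v', hv', ?_⟩
    have := hH₀mem v hv l hl hlA v' hv' ((y * v⁻¹)⁻¹ * (x * v'⁻¹))
      (mul_mem (inv_mem (hH₀ hy)) hx) (by convert hxC using 1; group)
    simpa only [mul_inv_cancel_left] using mul_mem hy this
  let I : G → Prop := fun x => x ∈ V ∨ ∃ y ∈ V, y⁻¹ * x ∈ R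
  have hI : ∀ x ∈ X, ∀ l ∈ LL, x * l ∈ X → I x → I (x * l) := by
    intro x hx l hl hxl hIx
    have hlΛ : l ∈ Λ := by
      obtain ⟨s, hs, hls⟩ := Set.mem_iUnion₂.1 hl
      exact hLΛ s hls
    rcases hIx with hxV | ⟨y, hy, hyx⟩
    · rcases hΛR l hlΛ with hlA | hlR
      · exact .inl (hVstep x hxV l (.inr hl) hlA _ hxl (by simp))
      · exact .inr ⟨x, hxV, by simpa using hlR⟩
    · rcases hRΛ _ hyx l hlΛ with h | h
      · exact .inr ⟨y, hy, by rwa [← mul_assoc]⟩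
      · exact .inl (hVstep y hy 1 (.inl rfl) A.one_mem _ hxl (by rwa [mul_one, ← mul_assoc]))
  have hIstep : ∀ n ∈ N, ∀ s ∈ S', I n → I (n * s) := by
    intro n hn s hs
    refine hwalk s X I n (fun p hp => ⟨n, hn, p, Set.mem_biUnion hs hp, rfl⟩) ?_
    exact fun x hx l hl => hI x hx l (Set.mem_biUnion hs hl)
  have hIN : ∀ n ∈ N, I n := by
    intro n hn
    rw [← hS] at hn
    induction hn using Subgroup.closure_induction_right with
    | one => exact .inl ⟨1, .inl rfl, by simp⟩
    | mul_right x hx y hy ih => exact hIstep x (hS ▸ hx) y (.inl hy) ih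
    | mul_inv_cancel x hx y hy ih =>
      exact hIstep x (hS ▸ hx) y⁻¹ (.inr (Set.inv_mem_inv.2 hy)) ih
  have heq : N ⊓ A = H₀ := by
    refine le_antisymm (fun h hh => ?_) hH₀
    rcases hIN h hh.1 with ⟨v, hv, hhv⟩ | ⟨y, hy, hyh⟩
    · have hvNA : v ∈ N ⊓ A := by
        simpa using mul_mem (inv_mem (hH₀ hhv)) hh
      have := hH₀mem v hv 1 (.inl rfl) A.one_mem 1 (.inl rfl) v hvNA (by simp)
      simpa using mul_mem hhv this
    · exact absurd (A.mul_mem (A.inv_mem (hVA y hy)) hh.2) (hRA _ hyh)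
  rw [heq]
  exact Subgroup.FG.iSup K hKfg

namespace Monoid.PushoutI

variable {ι H : Type*} {K : ι → Type*} [∀ i, Group (K i)] [Group H]

/-- `IsReducedFrom φ i j g` says that `g` is the product of a nonempty reduced word whose first
letter does not lie in `K i` and whose last letter lies in `K j`. -/
inductive IsReducedFrom (φ : ∀ i, H →* K i) (i : ι) : ι → PushoutI φ → Prop
  | single {j : ι} (hj : i ≠ j) (k : K j) (hk : k ∉ (φ j).range) : IsReducedFrom φ i j (of j k)
  | append {j l : ι} {g : PushoutI φ} (hg : IsReducedFrom φ i j g) (hjl : j ≠ l) (k : K l)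
      (hk : k ∉ (φ l).range) : IsReducedFrom φ i l (g * of l k)

variable {φ : ∀ i, H →* K i} {i j : ι} {g : PushoutI φ}

theorem IsReducedFrom.exists_neWord (h : IsReducedFrom φ i j g) :
    ∃ m, i ≠ m ∧ ∃ w : CoprodI.NeWord K m j, Reduced φ w.toWord ∧ ofCoprodI w.prod = g := by
  induction h with
  | @single j hj k hk =>
    refine ⟨j, hj, .singleton k (fun h => hk (h ▸ one_mem _)), ?_, by simp⟩
    simpa [Reduced, CoprodI.NeWord.toWord] using hk
  | append hg hjl k hk ih =>
    obtain ⟨m, hm, w, hw, rfl⟩ := ih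
    refine ⟨m, hm, w.append hjl (.singleton k (fun h => hk (h ▸ one_mem _))), ?_, by simp⟩
    intro x hx
    simp only [CoprodI.NeWord.toWord, CoprodI.NeWord.toList, List.mem_append,
      List.mem_singleton] at hx
    rcases hx with hx | rfl
    · exact hw x hx
    · exact hk

theorem _root_.Monoid.CoprodI.NeWord.not_mem_range_base (hφ : ∀ i, Function.Injective (φ i))
    (w : CoprodI.NeWord K i j) (hw : Reduced φ w.toWord) :
    ofCoprodI w.prod ∉ (base φ).range := fun h =>
  w.toList_ne_nil (congrArg CoprodI.Word.toList (hw.eq_empty_of_mem_range hφ h))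

theorem IsReducedFrom.not_mem_range_of (hφ : ∀ i, Function.Injective (φ i))
    (h : IsReducedFrom φ i j g) : g ∉ (of (φ := φ) i).range := by
  obtain ⟨m, hm, w, hw, rfl⟩ := h.exists_neWord
  rintro ⟨a, ha⟩
  by_cases haC : a ∈ (φ i).range
  · obtain ⟨c, rfl⟩ := haC
    exact w.not_mem_range_base hφ hw ⟨c, by rw [← ha, of_apply_eq_base]⟩
  · have ha1 : a⁻¹ ≠ 1 := fun h => haC (by simp [inv_eq_one.1 h])
    refine ((CoprodI.NeWord.singleton a⁻¹ ha1).append hm w).not_mem_range_base hφ ?_ ?_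
    · intro x hx
      simp only [CoprodI.NeWord.toWord, CoprodI.NeWord.toList, List.mem_append,
        List.mem_singleton] at hx
      rcases hx with rfl | hx
      · simpa using haC
      · exact hw x hx
    · simp [← ha]

theorem IsReducedFrom.mul_base (h : IsReducedFrom φ i j g) (c : H) :
    IsReducedFrom φ i j (g * base φ c) := by
  cases h with
  | single hj k hk =>
    rw [← of_apply_eq_base φ j, ← map_mul]
    exact .single hj _ (by rwa [Subgroup.mul_mem_cancel_right _ (MonoidHom.mem_range.2 ⟨c, rfl⟩)])
  | append hg hjl k hk =>
    rw [← of_apply_eq_base φ j, mul_assoc, ← map_mul]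
    exact .append hg hjl _ (by rwa [Subgroup.mul_mem_cancel_right _ (MonoidHom.mem_range.2 ⟨c, rfl⟩)])

theorem IsReducedFrom.mul_of (h : IsReducedFrom φ i j g) {l : ι} (k : K l) :
    (∃ m, IsReducedFrom φ i m (g * of l k)) ∨ g * of l k ∈ (base φ).range := by
  by_cases hjl : j = l
  · subst hjl
    cases h with
    | single hj k' hk' =>
      rw [← map_mul]
      by_cases hk : k' * k ∈ (φ j).range
      · obtain ⟨c, hc⟩ := hk
        exact .inr ⟨c, by rw [← hc, of_apply_eq_base]⟩
      · exact .inl ⟨j, .single hj _ hk⟩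
    | append hg hjl k' hk' =>
      rw [mul_assoc, ← map_mul]
      by_cases hk : k' * k ∈ (φ j).range
      · obtain ⟨c, hc⟩ := hk
        rw [← hc, of_apply_eq_base]
        exact .inl ⟨_, hg.mul_base c⟩
      · exact .inl ⟨j, .append hg hjl _ hk⟩
  · by_cases hk : k ∈ (φ l).range
    · obtain ⟨c, rfl⟩ := hk
      rw [of_apply_eq_base]
      exact .inl ⟨j, h.mul_base c⟩
    · exact .inl ⟨l, h.append hjl k hk⟩

theorem base_range_le_of_range (i : ι) : (base φ).range ≤ (of (φ := φ) i).range := by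
  rintro _ ⟨c, rfl⟩
  exact ⟨φ i c, of_apply_eq_base φ i c⟩

theorem closure_iUnion_range_of [Nonempty ι] :
    Submonoid.closure (⋃ i, Set.range (of (φ := φ) i)) = ⊤ := by
  rw [eq_top_iff]
  rintro x -
  induction x using PushoutI.induction_on with
  | of i k => exact Submonoid.subset_closure (Set.mem_iUnion.2 ⟨i, k, rfl⟩)
  | base c =>
    obtain ⟨i⟩ := ‹Nonempty ι›
    exact Submonoid.subset_closure (Set.mem_iUnion.2 ⟨i, base_range_le_of_range i ⟨c, rfl⟩⟩)
  | mul x y hx hy => exact mul_mem hx hy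

theorem fg_inf_range_of (hφ : ∀ i, Function.Injective (φ i)) {N : Subgroup (PushoutI φ)}
    (hN : N.Normal) (hNfg : N.FG) (hNC : (N ⊓ (base φ).range).FG) (i : ι) :
    (N ⊓ (of (φ := φ) i).range).FG := by
  have : Nonempty ι := ⟨i⟩
  refine fg_inf_of_branch (R := {g | ∃ j, IsReducedFrom φ i j g}) (base_range_le_of_range i)
    closure_iUnion_range_of ?_ ?_ ?_ hN hNfg hNC
  · intro g hg
    obtain ⟨j, k, rfl⟩ := Set.mem_iUnion.1 hg
    by_cases hij : i = j
    · subst hij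
      exact .inl ⟨k, rfl⟩
    · by_cases hk : k ∈ (φ j).range
      · obtain ⟨c, rfl⟩ := hk
        rw [of_apply_eq_base]
        exact .inl (base_range_le_of_range i ⟨c, rfl⟩)
      · exact .inr ⟨j, .single hij k hk⟩
  · rintro r ⟨j, hr⟩ g hg
    obtain ⟨l, k, rfl⟩ := Set.mem_iUnion.1 hg
    exact hr.mul_of k
  · rintro r ⟨j, hr⟩
    exact hr.not_mem_range_of hφ

end Monoid.PushoutI

/-- Let `G = A ∗_C B` be a nontrivial amalgamated free product and `N` a normal
subgroup of `G`.  If `N` is finitely generated, `N` is not contained in `C`, and `N ⊓ C` is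
finitely generated, then `N ⊓ A` and `N ⊓ B` are finitely generated. -/
theorem stmt_1 {H : Type*} [Group H] {K : Bool → Type*} [∀ i, Group (K i)]
    (φ : ∀ i, H →* K i) (hφ : ∀ i, Function.Injective (φ i))
    (A B C N : Subgroup (PushoutI φ))
    (hA : A = (PushoutI.of (φ := φ) true).range)
    (hB : B = (PushoutI.of (φ := φ) false).range)
    (hC : C = (PushoutI.base φ).range)
    (hAC : A ≠ C) (hBC : B ≠ C)
    (hNnorm : N.Normal) (hNfg : N.FG) (hNC : ¬ N ≤ C)
    (hNCfg : (N ⊓ C).FG) :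
    (N ⊓ A).FG ∧ (N ⊓ B).FG := by
  subst hA hB hC
  exact ⟨PushoutI.fg_inf_range_of hφ hNnorm hNfg hNCfg true,
    PushoutI.fg_inf_range_of hφ hNnorm hNfg hNCfg false⟩
end

section
/- Let G = A∗_C be an HNN extension with base group A, associated subgroups C and D, and stable letter t, and let N be a normal subgroup of G. If N is finitely generated and N is not contained in C, then the subgroup NC generated by N and C has finite index in G. -/
section HalfSpaces

open scoped Pointwise

namespace MulAction

variable {G V : Type*} [Group G] [MulAction G V]

theorem smul_set_ssubset_smul_set {K L : Set V} (g : G) (h : K ⊂ L) : g • K ⊂ g • L :=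
  ⟨Set.smul_set_mono h.subset, fun hLK => h.not_subset (Set.smul_set_subset_smul_set_iff.1 hLK)⟩

/-- A subset cannot be moved strictly into a larger one by `g` while all of its translates under
the powers of `g` separate the same two points, if only finitely many translates do. -/
theorem not_forall_pow_smul_separates {K : Set V} {g : G} (hg : K ⊂ g • K)
    {x y : V} (hfin : {Z ∈ orbit G K | x ∈ Z ∧ y ∉ Z}.Finite) (hx : x ∈ K) :
    ∃ k : ℕ, y ∈ g ^ k • K := by
  by_contra! hy
  have hmono : StrictMono fun k : ℕ => g ^ k • K := by
    refine strictMono_nat_of_lt_succ fun k => ?_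
    rw [pow_succ, mul_smul]
    exact smul_set_ssubset_smul_set _ hg
  refine Set.infinite_range_of_injective hmono.injective (hfin.subset ?_)
  rintro _ ⟨k, rfl⟩
  refine ⟨⟨_, rfl⟩, ?_, hy k⟩
  have : K ⊆ g ^ k • K := by simpa using hmono.monotone (Nat.zero_le k)
  exact this hx

/-- If a set `K` with nested translates lies strictly inside one of its translates, and a point
lies outside of all its translates under a finitely generated normal subgroup `N`, then `N`
stabilizes `K`. -/
theorem le_stabilizer_of_forall_notMem_smul {K : Set V} {N : Subgroup G} (hN : N.Normal)
    (hfg : N.FG)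
    (hnest : ∀ g : G, g • K ⊆ K ∨ Disjoint (g • K) K ∨ K ⊆ g • K ∨ g • K ∪ K = Set.univ)
    (hfin : ∀ x y : V, {Z ∈ orbit G K | x ∈ Z ∧ y ∉ Z}.Finite)
    (hne : K.Nonempty) {s : G} (hs : K ⊂ s • K) {w : V} (hw : ∀ n ∈ N, w ∉ n • K) :
    N ≤ stabilizer G K := by
  obtain ⟨x, hx⟩ := hne
  have not_ssubset : ∀ n ∈ N, ¬ K ⊂ n • K := fun n hn h => by
    obtain ⟨k, hk⟩ := not_forall_pow_smul_separates h (hfin x w) hx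
    exact hw _ (N.pow_mem hn k) hk
  have eq_or_disjoint : ∀ n ∈ N, n • K = K ∨ Disjoint (n • K) K := by
    intro n hn
    rcases hnest n with h | h | h | h
    · refine Or.inl (by_contra fun hne => not_ssubset n⁻¹ (N.inv_mem hn) ?_)
      have := smul_set_ssubset_smul_set n⁻¹ (h.ssubset_of_ne hne)
      rwa [inv_smul_smul] at this
    · exact Or.inr h
    · exact Or.inl (by_contra fun hne => not_ssubset n hn (h.ssubset_of_ne (Ne.symm hne)))
    · have : w ∈ n • K ∪ K := h ▸ Set.mem_univ w
      rcases this with h | h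
      · exact absurd h (hw n hn)
      · exact absurd (by simpa using h) (hw 1 N.one_mem)
  obtain ⟨S, rfl⟩ := hfg
  have hmono : Monotone fun k : ℕ => s ^ k • K := by
    refine monotone_nat_of_le_succ fun k => ?_
    change s ^ k • K ⊆ s ^ (k + 1) • K
    rw [pow_succ, mul_smul]
    exact Set.smul_set_mono hs.subset
  choose k hk using fun σ : G => not_forall_pow_smul_separates hs (hfin x (σ • x)) hx
  set m := S.sup k
  have hstab : Subgroup.closure (S : Set G) ≤ stabilizer G (s ^ m • K) := by
    rw [Subgroup.closure_le]
    intro σ hσ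
    have hσN := Subgroup.subset_closure (k := (S : Set G)) hσ
    have h1 : σ • x ∈ s ^ m • K := hmono (Finset.le_sup (f := k) hσ) (hk σ)
    have h2 : x ∈ s ^ m • K := by
      have : K ⊆ s ^ m • K := by simpa using hmono (Nat.zero_le m)
      exact this hx
    have hconj := hN.conj_mem σ hσN (s ^ m)⁻¹
    rw [inv_inv] at hconj
    change σ • s ^ m • K = s ^ m • K
    rcases eq_or_disjoint _ hconj with h | h
    · rwa [mul_smul, mul_smul, inv_smul_eq_iff] at h
    · refine absurd h (Set.not_disjoint_iff.2 ⟨(s ^ m)⁻¹ • σ • x, ?_, ?_⟩)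
      · rw [mul_smul, mul_smul, Set.smul_mem_smul_set_iff, Set.smul_mem_smul_set_iff]
        exact h2
      · rwa [← Set.mem_smul_set_iff_inv_smul_mem]
  intro n hn
  have := hstab (hN.conj_mem n hn (s ^ m))
  rw [mem_stabilizer_iff, mul_smul, inv_smul_smul, mul_smul] at this
  exact smul_left_cancel _ this

theorem finite_separating_compl {X : Set V}
    (hfin : ∀ x y : V, {Z ∈ orbit G X | x ∈ Z ∧ y ∉ Z}.Finite) (x y : V) :
    {Z ∈ orbit G Xᶜ | x ∈ Z ∧ y ∉ Z}.Finite := by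
  refine ((hfin y x).image compl).subset ?_
  rintro _ ⟨⟨g, rfl⟩, hx, hy⟩
  refine ⟨g • X, ⟨⟨g, rfl⟩, ?_, ?_⟩, ?_⟩ <;> simp_all [Set.smul_set_compl]

/-- Let `X` be a set with nested translates of which only finitely many separate two given points,
and lying strictly inside one of its translates. Then a finitely generated normal subgroup that is
not contained in the stabilizer of `X` generates with it a subgroup of finite index. -/
theorem finiteIndex_sup_stabilizer {X : Set V} {N : Subgroup G} (hN : N.Normal) (hfg : N.FG)
    (hnest : ∀ g : G, g • X ⊆ X ∨ Disjoint (g • X) X ∨ X ⊆ g • X ∨ g • X ∪ X = Set.univ)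
    (hfin : ∀ x y : V, {Z ∈ orbit G X | x ∈ Z ∧ y ∉ Z}.Finite)
    (hne : X.Nonempty) (hne' : Xᶜ.Nonempty) {s : G} (hs : X ⊂ s • X)
    (hNX : ¬ N ≤ stabilizer G X) :
    (N ⊔ stabilizer G X).FiniteIndex := by
  by_contra hindex
  obtain ⟨e, -⟩ := id hne
  obtain ⟨S, hS⟩ := id hfg
  let E : Set (Set V) := ⋃ σ ∈ S, {Z ∈ orbit G X | ¬ (e ∈ Z ↔ σ • e ∈ Z)}
  have hE : E.Finite := by
    refine S.finite_toSet.biUnion fun σ _ => ((hfin e (σ • e)).union (hfin (σ • e) e)).subset ?_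
    rintro Z ⟨hZ, h⟩
    by_cases h1 : e ∈ Z
    · exact Or.inl ⟨hZ, h1, fun h2 => h (by tauto)⟩
    · exact Or.inr ⟨hZ, by tauto, h1⟩
  obtain ⟨g, hg⟩ : ∃ g : G, ∀ n ∈ N, (n * g) • X ∉ E := by
    by_contra! hcov
    apply hindex
    suffices Finite (G ⧸ (N ⊔ stabilizer G X)) from Subgroup.finiteIndex_of_finite_quotient
    have : Finite E := hE
    have hE' : ∀ Z : E, ∃ g : G, g • X = Z := by
      rintro ⟨Z, hZ⟩
      simp only [E, Set.mem_iUnion] at hZ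
      obtain ⟨σ, -, hZ, -⟩ := hZ
      exact hZ
    choose r hr using hE'
    refine Finite.of_surjective (fun Z : E => (r Z : G ⧸ (N ⊔ stabilizer G X))) fun q => ?_
    induction q using QuotientGroup.induction_on with
    | H g =>
      obtain ⟨n, hn, hng⟩ := hcov g
      refine ⟨⟨_, hng⟩, QuotientGroup.eq.2 ?_⟩
      have h := hr ⟨_, hng⟩
      set a := r ⟨_, hng⟩
      have h1 : a⁻¹ * (n * g) ∈ stabilizer G X := by
        rw [mem_stabilizer_iff, mul_smul, inv_smul_eq_iff, h]
      have h2 : a⁻¹ * n⁻¹ * a ∈ N := by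
        simpa using hN.conj_mem _ (N.inv_mem hn) a⁻¹
      have : a⁻¹ * g = a⁻¹ * n⁻¹ * a * (a⁻¹ * (n * g)) := by group
      rw [this]
      exact mul_mem (Subgroup.mem_sup_left h2) (Subgroup.mem_sup_right h1)
  have hsame : ∀ n ∈ N, ∀ m ∈ N, (e ∈ (m * g) • X ↔ n • e ∈ (m * g) • X) := by
    intro n hn
    rw [← hS] at hn
    induction hn using Subgroup.closure_induction with
    | mem σ hσ =>
      intro m hm
      by_contra h
      exact hg m hm (Set.mem_biUnion hσ ⟨⟨_, rfl⟩, h⟩)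
    | one => simp
    | mul a b ha hb iha ihb =>
      intro m hm
      rw [hS] at ha
      have := ihb (a⁻¹ * m) (N.mul_mem (N.inv_mem ha) hm)
      rw [mul_assoc, mul_smul, Set.mem_inv_smul_set_iff, Set.mem_inv_smul_set_iff, ← mul_smul]
        at this
      rw [iha m hm, this]
    | inv a ha iha =>
      intro m hm
      rw [hS] at ha
      have := iha (a * m) (N.mul_mem ha hm)
      rw [mul_assoc, mul_smul, Set.smul_mem_smul_set_iff, Set.mem_smul_set_iff_inv_smul_mem]
        at this
      exact this.symm
  have hw : ∀ n ∈ N, (g⁻¹ • e ∈ n • X ↔ g⁻¹ • e ∈ X) := by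
    intro n hn
    have h1 := hN.conj_mem n hn g
    have h := hsame _ (N.inv_mem h1) 1 N.one_mem
    rw [one_mul, Set.mem_smul_set_iff_inv_smul_mem, Set.mem_smul_set_iff_inv_smul_mem] at h
    rw [h, Set.mem_smul_set_iff_inv_smul_mem, ← mul_smul, ← mul_smul]
    simp [mul_assoc]
  by_cases hX : g⁻¹ • e ∈ X
  · have := le_stabilizer_of_forall_notMem_smul (K := Xᶜ) (s := s⁻¹) (w := g⁻¹ • e) hN hfg ?_
      (finite_separating_compl hfin) hne' ?_ ?_
    · refine hNX fun n hn => ?_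
      simpa [mem_stabilizer_iff, Set.smul_set_compl] using this hn
    · intro h
      simp only [Set.smul_set_compl, Set.compl_subset_compl]
      rcases hnest h with h | h | h | h
      · exact Or.inr (Or.inr (Or.inl h))
      · right; right; right
        rw [← Set.compl_inter, h.inter_eq, Set.compl_empty]
      · exact Or.inl h
      · right; left
        rw [Set.disjoint_iff_inter_eq_empty, ← Set.compl_union, h, Set.compl_univ]
    · rw [Set.smul_set_compl]
      refine compl_lt_compl_iff_lt.2 ?_
      have := smul_set_ssubset_smul_set s⁻¹ hs
      rwa [inv_smul_smul] at this
    · intro n hn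
      simpa [Set.smul_set_compl, hw n hn] using hX
  · exact hNX (le_stabilizer_of_forall_notMem_smul hN hfg hnest hfin hne hs
      fun n hn => by rwa [hw n hn])

end MulAction

namespace HNNExtension

open NormalWord

variable {A : Type*} [Group A] {C D : Subgroup A} {φ : C ≃* D} {d : TransversalPair A C D}

variable (d) in
/-- The normal words that cancel with `t ^ u`: a half-space of the Bass–Serre tree. -/
def halfSpace (u : ℤˣ) : Set (NormalWord d) := {w | Cancels u w}

theorem disjoint_of_smul_halfSpace {u v : ℤˣ} {a : A}
    (h : a ∈ toSubgroup C D v → u ≠ v) :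
    Disjoint ((of a : HNNExtension A C D φ) • halfSpace d u) (halfSpace d v) := by
  rw [Set.disjoint_left]
  rintro _ ⟨w, ⟨hw1, hw2⟩, rfl⟩ ⟨hv1, hv2⟩
  simp only [of_smul_eq_smul, group_smul_head, group_smul_toList] at hv1 hv2
  rw [hw2, Option.some_inj, neg_inj] at hv2
  subst hv2
  exact h ((Subgroup.mul_mem_cancel_right _ hw1).1 hv1) rfl

theorem of_smul_halfSpace {u : ℤˣ} {a : A} (ha : a ∈ toSubgroup C D u) :
    (of a : HNNExtension A C D φ) • halfSpace d u = halfSpace d u := by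
  ext w
  rw [Set.mem_smul_set_iff_inv_smul_mem, ← map_inv, of_smul_eq_smul]
  simp [halfSpace, Cancels, Subgroup.mul_mem_cancel_left, ha]

theorem zpow_smul_halfSpace (u : ℤˣ) :
    (t ^ (u : ℤ) : HNNExtension A C D φ) • halfSpace d u = (halfSpace d (-u))ᶜ := by
  ext w
  rw [Set.mem_smul_set_iff_inv_smul_mem, ← zpow_neg, ← Units.val_neg, t_pow_smul_eq_unitsSMul]
  have := unitsSMul_cancels_iff φ (-u) w
  rw [neg_neg] at this
  exact this

theorem empty_notMem_of_smul_halfSpace (u : ℤˣ) (a : A) :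
    empty ∉ (of a : HNNExtension A C D φ) • halfSpace d u := by
  rw [Set.mem_smul_set_iff_inv_smul_mem, ← map_inv, of_smul_eq_smul]
  simp [halfSpace, Cancels]

theorem empty_notMem_halfSpace (u : ℤˣ) : empty ∉ halfSpace d u := by
  simp [halfSpace, Cancels]

theorem zpow_neg_smul_empty_mem_halfSpace (u : ℤˣ) :
    (t ^ (-u : ℤ) : HNNExtension A C D φ) • empty ∈ halfSpace d u := by
  have h := zpow_smul_halfSpace (φ := φ) (d := d) u
  rw [zpow_neg, ← Set.mem_smul_set_iff_inv_smul_mem, h]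
  exact empty_notMem_halfSpace _

theorem of_smul_halfSpace_eq_of_mem {u v : ℤˣ} {a : A} {x : NormalWord d}
    (hx : x ∈ (of a : HNNExtension A C D φ) • halfSpace d u) (hv : x ∈ halfSpace d v) :
    (of a : HNNExtension A C D φ) • halfSpace d u = halfSpace d v := by
  by_cases h : a ∈ toSubgroup C D v → u ≠ v
  · exact absurd hv (Set.disjoint_left.1 (disjoint_of_smul_halfSpace h) hx)
  · push Not at h
    obtain ⟨ha, rfl⟩ := h
    exact of_smul_halfSpace ha

theorem zpow_mul_of_smul_halfSpace_ssubset {u v : ℤˣ} {a : A}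
    (h : a ∈ toSubgroup C D u → u = -v) :
    (t ^ (u : ℤ) * of a : HNNExtension A C D φ) • halfSpace d v ⊂ halfSpace d (-u) := by
  have h' : (of a : HNNExtension A C D φ) • halfSpace d v ⊂ (halfSpace d u)ᶜ := by
    refine (Set.ssubset_iff_of_subset ?_).2
      ⟨empty, empty_notMem_halfSpace _, empty_notMem_of_smul_halfSpace _ _⟩
    refine Set.subset_compl_iff_disjoint_right.2 (disjoint_of_smul_halfSpace fun ha hvu => ?_)
    subst hvu
    exact units_ne_neg_self _ (h ha)
  have := MulAction.smul_set_ssubset_smul_set (t ^ (u : ℤ) : HNNExtension A C D φ) h'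
  rwa [Set.smul_set_compl, zpow_smul_halfSpace, compl_compl, ← mul_smul] at this

theorem prod_smul_halfSpace_ssubset {v : ℤˣ} (l : List (ℤˣ × A)) (u : ℤˣ) (a : A)
    (h : ((u, a) :: (l ++ [(-v, 1)])).IsChain
      (fun a b : ℤˣ × A => a.2 ∈ toSubgroup C D a.1 → a.1 = b.1)) :
    (t ^ (u : ℤ) * of a * (l.map fun x => t ^ (x.1 : ℤ) * of x.2).prod :
      HNNExtension A C D φ) • halfSpace d v ⊂ halfSpace d (-u) := by
  induction l generalizing u a with
  | nil =>
    simp only [List.nil_append, List.isChain_cons_cons] at h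
    simpa using zpow_mul_of_smul_halfSpace_ssubset h.1
  | cons b l ih =>
    simp only [List.cons_append, List.isChain_cons_cons] at h
    have h1 := ih b.1 b.2 h.2
    rw [List.map_cons, List.prod_cons, mul_smul]
    refine (MulAction.smul_set_ssubset_smul_set _ h1).trans
      (zpow_mul_of_smul_halfSpace_ssubset ?_)
    simpa using h.1

theorem smul_halfSpace_trichotomy (g : HNNExtension A C D φ) (v : ℤˣ) :
    (∃ a, g = of a) ∨ (∃ a u, g • halfSpace d v ⊂ (of a : HNNExtension A C D φ) • halfSpace d u) ∨
      ∃ a u, (g • halfSpace d v)ᶜ ⊆ (of a : HNNExtension A C D φ) • halfSpace d u := by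
  obtain ⟨w, rfl⟩ := (equiv φ d).symm.surjective g
  obtain ⟨⟨a, l, hl⟩, -⟩ := w
  change (∃ b, ReducedWord.prod φ ⟨a, l, hl⟩ = of b) ∨ (∃ b u,
    ReducedWord.prod φ ⟨a, l, hl⟩ • halfSpace d v ⊂ (of b : HNNExtension A C D φ) • halfSpace d u) ∨
      ∃ b u, (ReducedWord.prod φ ⟨a, l, hl⟩ • halfSpace d v)ᶜ ⊆
        (of b : HNNExtension A C D φ) • halfSpace d u
  simp only [ReducedWord.prod]
  rcases List.eq_nil_or_concat' l with rfl | ⟨l, ⟨u, b⟩, rfl⟩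
  · exact Or.inl ⟨a, by simp⟩
  by_cases hb : b ∈ toSubgroup C D u → u = -v
  · right; left
    have hl' : ((l ++ [(u, b)]) ++ [(-v, 1)]).IsChain
        (fun a b : ℤˣ × A => a.2 ∈ toSubgroup C D a.1 → a.1 = b.1) := by
      rw [List.isChain_append]
      refine ⟨hl, by simp, ?_⟩
      simpa using hb
    rcases l with _ | ⟨⟨u₁, a₁⟩, l⟩
    · have h := prod_smul_halfSpace_ssubset (φ := φ) (d := d) (v := v) [] u b (by simpa using hl')
      refine ⟨a, -u, ?_⟩
      rw [mul_smul]
      exact MulAction.smul_set_ssubset_smul_set _ (by simpa using h)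
    · have h := prod_smul_halfSpace_ssubset (φ := φ) (d := d) (v := v) (l ++ [(u, b)]) u₁ a₁
        (by simpa using hl')
      refine ⟨a, -u₁, ?_⟩
      rw [mul_smul]
      exact MulAction.smul_set_ssubset_smul_set _ (by simpa using h)
  · right; right
    push Not at hb
    obtain ⟨hb, huv⟩ := hb
    obtain rfl : u = v := by
      rw [Int.units_ne_iff_eq_neg, neg_neg] at huv
      exact huv
    have hcompl : (((t ^ (u : ℤ) : HNNExtension A C D φ) * of b) • halfSpace d u)
        = (halfSpace d (-u))ᶜ := by
      rw [mul_smul, of_smul_halfSpace hb, zpow_smul_halfSpace]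
    rw [List.map_append, List.prod_append, List.map_singleton, List.prod_singleton, ← mul_assoc,
      mul_smul, hcompl, Set.smul_set_compl, compl_compl]
    rcases l with _ | ⟨⟨u₁, a₁⟩, l⟩
    · exact ⟨a, -u, by simp⟩
    · have hl' : ((u₁, a₁) :: (l ++ [(- -u, 1)])).IsChain
          (fun a b : ℤˣ × A => a.2 ∈ toSubgroup C D a.1 → a.1 = b.1) := by
        rw [List.isChain_append] at hl
        rw [← List.cons_append, List.isChain_append]
        refine ⟨hl.1, by simp, ?_⟩
        simpa using hl.2.2
      have h := prod_smul_halfSpace_ssubset (φ := φ) (d := d) l u₁ a₁ hl'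
      refine ⟨a, -u₁, ?_⟩
      rw [mul_smul]
      exact Set.smul_set_mono (by simpa using h.subset)

theorem smul_halfSpace_subset_or (g : HNNExtension A C D φ) (v : ℤˣ) :
    (∃ a u, g • halfSpace d v ⊆ (of a : HNNExtension A C D φ) • halfSpace d u) ∨
      ∃ a u, (g • halfSpace d v)ᶜ ⊆ (of a : HNNExtension A C D φ) • halfSpace d u := by
  rcases smul_halfSpace_trichotomy (d := d) g v with ⟨a, rfl⟩ | ⟨a, u, h⟩ | h
  · exact Or.inl ⟨a, v, subset_rfl⟩
  · exact Or.inl ⟨a, u, h.subset⟩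
  · exact Or.inr h

theorem stabilizer_halfSpace_one :
    MulAction.stabilizer (HNNExtension A C D φ) (halfSpace d 1) = C.map of := by
  have hmem := zpow_neg_smul_empty_mem_halfSpace (φ := φ) (d := d) 1
  ext g
  constructor
  · intro hg
    rw [MulAction.mem_stabilizer_iff] at hg
    rcases smul_halfSpace_trichotomy (d := d) g 1 with ⟨a, rfl⟩ | ⟨a, u, h⟩ | ⟨a, u, h⟩
    · refine ⟨a, by_contra fun ha => ?_, rfl⟩
      have := disjoint_of_smul_halfSpace (φ := φ) (d := d) (u := 1) (v := 1) (a := a)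
        fun h => absurd h ha
      rw [hg] at this
      exact Set.disjoint_left.1 this hmem hmem
    · rw [hg] at h
      exact absurd (of_smul_halfSpace_eq_of_mem (h.subset hmem) hmem) h.ne'
    · rw [hg] at h
      exact absurd (h (empty_notMem_halfSpace 1)) (empty_notMem_of_smul_halfSpace u a)
  · rintro ⟨c, hc, rfl⟩
    exact of_smul_halfSpace hc

theorem smul_halfSpace_nested (g : HNNExtension A C D φ) (v : ℤˣ) :
    g • halfSpace d v ⊆ halfSpace d v ∨ Disjoint (g • halfSpace d v) (halfSpace d v) ∨
      halfSpace d v ⊆ g • halfSpace d v ∨ g • halfSpace d v ∪ halfSpace d v = Set.univ := by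
  have key : ∀ (a : A) (u : ℤˣ), (of a : HNNExtension A C D φ) • halfSpace d u = halfSpace d v ∨
      Disjoint ((of a : HNNExtension A C D φ) • halfSpace d u) (halfSpace d v) := by
    intro a u
    by_contra! h
    obtain ⟨x, hx, hx'⟩ := Set.not_disjoint_iff.1 h.2
    exact h.1 (of_smul_halfSpace_eq_of_mem hx hx')
  rcases smul_halfSpace_subset_or (d := d) g v with ⟨a, u, h⟩ | ⟨a, u, h⟩ <;>
    rcases key a u with h' | h'
  · exact Or.inl (h' ▸ h)
  · exact Or.inr (Or.inl (h'.mono_left h))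
  · right; right; right
    rw [h', Set.compl_subset_iff_union] at h
    exact h
  · right; right; left
    have := h'.mono_left h
    rwa [Set.disjoint_compl_left_iff_subset] at this

theorem halfSpace_one_ssubset_t_smul :
    halfSpace d 1 ⊂ (t : HNNExtension A C D φ) • halfSpace d 1 := by
  have h := zpow_smul_halfSpace (φ := φ) (d := d) 1
  rw [Units.val_one, zpow_one] at h
  rw [h]
  refine (Set.ssubset_iff_of_subset ?_).2
      ⟨empty, empty_notMem_halfSpace _, empty_notMem_halfSpace _⟩
  rw [Set.subset_compl_iff_disjoint_right]
  simpa using disjoint_of_smul_halfSpace (φ := φ) (d := d) (u := 1) (v := -1) (a := 1)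
    fun _ => units_ne_neg_self 1

theorem empty_mem_iff_of_smul_empty_mem (g : HNNExtension A C D φ) (v : ℤˣ) (a : A) :
    empty ∈ g • halfSpace d v ↔
      (of a : HNNExtension A C D φ) • (empty : NormalWord d) ∈ g • halfSpace d v := by
  have key : ∀ (b : A) (u : ℤˣ), (of a : HNNExtension A C D φ) • (empty : NormalWord d) ∉
      (of b : HNNExtension A C D φ) • halfSpace d u := by
    intro b u
    rw [← Set.mem_inv_smul_set_iff, ← mul_smul, ← map_inv, ← map_mul]
    exact empty_notMem_of_smul_halfSpace _ _
  rcases smul_halfSpace_subset_or (d := d) g v with ⟨b, u, h⟩ | ⟨b, u, h⟩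
  · exact iff_of_false (fun h' => empty_notMem_of_smul_halfSpace _ _ (h h')) fun h' => key _ _ (h h')
  · exact iff_of_true (by_contra fun h' => empty_notMem_of_smul_halfSpace _ _ (h h'))
      (by_contra fun h' => key _ _ (h h'))

theorem smul_halfSpace_eq_or_of_separates (g : HNNExtension A C D φ)
    (hsep : ¬ (empty ∈ g • halfSpace d 1 ↔
      (t : HNNExtension A C D φ) • (empty : NormalWord d) ∈ g • halfSpace d 1)) :
    g • halfSpace d 1 = halfSpace d (-1) ∨ g • halfSpace d 1 = (halfSpace d (-1))ᶜ := by
  have ht : (t : HNNExtension A C D φ) • (empty : NormalWord d) ∈ halfSpace d (-1) := by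
    simpa using zpow_neg_smul_empty_mem_halfSpace (φ := φ) (d := d) (-1)
  have ht' : (t⁻¹ : HNNExtension A C D φ) • (empty : NormalWord d) ∈ halfSpace d 1 := by
    simpa using zpow_neg_smul_empty_mem_halfSpace (φ := φ) (d := d) 1
  have hX : (t⁻¹ : HNNExtension A C D φ) • halfSpace d (-1) = (halfSpace d 1)ᶜ := by
    simpa using zpow_smul_halfSpace (φ := φ) (d := d) (-1)
  -- A set containing `t • empty` is this half-space if it lies in a half-space at `empty` and the
  -- complement of its translate by `t⁻¹` does as well.
  have key : ∀ Z : Set (NormalWord d), (t : HNNExtension A C D φ) • (empty : NormalWord d) ∈ Z →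
      (∃ a u, Z ⊆ (of a : HNNExtension A C D φ) • halfSpace d u) →
      (∃ a u, ((t⁻¹ : HNNExtension A C D φ) • Z)ᶜ ⊆
        (of a : HNNExtension A C D φ) • halfSpace d u) → Z = halfSpace d (-1) := by
    rintro Z hZ ⟨a, u, h1⟩ ⟨b, v, h2⟩
    rw [of_smul_halfSpace_eq_of_mem (h1 hZ) ht] at h1
    refine h1.antisymm ?_
    have h3 := Set.smul_set_mono (a := (t⁻¹ : HNNExtension A C D φ)) h1
    rw [hX] at h3
    have h4 : halfSpace d 1 ⊆ ((t⁻¹ : HNNExtension A C D φ) • Z)ᶜ :=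
      Set.subset_compl_comm.1 h3
    rw [of_smul_halfSpace_eq_of_mem (h2 (h4 ht')) ht', Set.compl_subset_comm, ← hX,
      Set.smul_set_subset_smul_set_iff] at h2
    exact h2
  have h1 := smul_halfSpace_subset_or (d := d) g 1
  have h2 := smul_halfSpace_subset_or (d := d) (t⁻¹ * g) 1
  have hnot : ∀ Z : Set (NormalWord d), empty ∈ Z →
      ¬ ∃ a u, Z ⊆ (of a : HNNExtension A C D φ) • halfSpace d u := by
    rintro Z hZ ⟨a, u, h⟩
    exact empty_notMem_of_smul_halfSpace _ _ (h hZ)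
  rw [mul_smul] at h2
  by_cases he : empty ∈ g • halfSpace d 1
  · have hte : (t : HNNExtension A C D φ) • (empty : NormalWord d) ∈ (g • halfSpace d 1)ᶜ :=
      fun h => hsep (iff_of_true he h)
    right
    rw [← compl_inj_iff, compl_compl]
    refine key _ hte (h1.resolve_left (hnot _ he)) ?_
    rw [Set.smul_set_compl, compl_compl]
    refine h2.resolve_right (hnot _ ?_)
    rw [← Set.smul_set_compl, Set.mem_inv_smul_set_iff]
    exact hte
  · have hte : (t : HNNExtension A C D φ) • (empty : NormalWord d) ∈ g • halfSpace d 1 :=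
      by_contra fun h => hsep (iff_of_false he h)
    left
    refine key _ hte (h1.resolve_right (hnot _ he)) (h2.resolve_left (hnot _ ?_))
    rw [Set.mem_inv_smul_set_iff]
    exact hte

theorem finite_separating (g h : HNNExtension A C D φ) :
    {Z ∈ MulAction.orbit (HNNExtension A C D φ) (halfSpace d 1) |
      ¬ (g • empty ∈ Z ↔ h • empty ∈ Z)}.Finite := by
  have translate : ∀ p x y : HNNExtension A C D φ,
      {Z ∈ MulAction.orbit (HNNExtension A C D φ) (halfSpace d 1) |
        ¬ (x • empty ∈ Z ↔ y • empty ∈ Z)}.Finite →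
      {Z ∈ MulAction.orbit (HNNExtension A C D φ) (halfSpace d 1) |
        ¬ ((p * x) • empty ∈ Z ↔ (p * y) • empty ∈ Z)}.Finite := by
    intro p x y hf
    refine (hf.image (p • ·)).subset ?_
    rintro Z ⟨hZ, h⟩
    refine ⟨p⁻¹ • Z, ⟨?_, ?_⟩, smul_inv_smul p Z⟩
    · rwa [← MulAction.orbit_eq_iff, MulAction.orbit_smul, MulAction.orbit_eq_iff]
    · rwa [Set.mem_inv_smul_set_iff, Set.mem_inv_smul_set_iff, ← mul_smul, ← mul_smul]
  suffices base : ∀ q : HNNExtension A C D φ,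
      {Z ∈ MulAction.orbit (HNNExtension A C D φ) (halfSpace d 1) |
        ¬ ((1 : HNNExtension A C D φ) • empty ∈ Z ↔ q • empty ∈ Z)}.Finite by
    simpa using translate g 1 (g⁻¹ * h) (base _)
  intro q
  induction q using HNNExtension.induction_on with
  | of a =>
    refine Set.finite_empty.subset ?_
    rintro _ ⟨⟨g, rfl⟩, h⟩
    rw [one_smul] at h
    exact h (empty_mem_iff_of_smul_empty_mem g 1 a)
  | t =>
    refine (Set.toFinite {halfSpace d (-1), (halfSpace d (-1))ᶜ}).subset ?_
    rintro _ ⟨⟨g, rfl⟩, h⟩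
    rw [one_smul] at h
    exact smul_halfSpace_eq_or_of_separates g h
  | mul x y hx hy =>
    have := translate x 1 y hy
    rw [mul_one] at this
    refine (hx.union this).subset ?_
    rintro Z ⟨hZ, h⟩
    by_contra h'
    simp only [Set.mem_union, Set.mem_ofPred_eq, hZ, true_and] at h'
    tauto
  | inv x hx =>
    have := translate x⁻¹ 1 x hx
    rw [mul_one, inv_mul_cancel] at this
    refine this.subset ?_
    rintro Z ⟨hZ, h⟩
    exact ⟨hZ, fun h' => h h'.symm⟩

theorem finite_separating_halfSpace (x y : NormalWord d) :
    {Z ∈ MulAction.orbit (HNNExtension A C D φ) (halfSpace d 1) | x ∈ Z ∧ y ∉ Z}.Finite := by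
  have h := finite_separating (d := d) (x.prod φ) (y.prod φ)
  rw [prod_smul_empty, prod_smul_empty] at h
  exact h.subset fun Z hZ => ⟨hZ.1, fun h => hZ.2.2 (h.1 hZ.2.1)⟩

end HNNExtension

end HalfSpaces

/-- Let `G = A∗_C` be an HNN extension with base group `A`, associated
subgroups `C` and `D` (identified with their images in `G` via the canonical injection
`HNNExtension.of`), and let `N` be a normal subgroup of `G`.  If `N` is finitely generated
and `N` is not contained in `C`, then the subgroup `N ⊔ C` generated by `N` and `C` has
finite index in `G`. -/
theorem stmt_4 {A : Type*} [Group A] (C D : Subgroup A) (φ : C ≃* D)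
    (N : Subgroup (HNNExtension A C D φ)) (hNnorm : N.Normal) (hNfg : N.FG)
    (hNC : ¬ N ≤ Subgroup.map (HNNExtension.of : A →* HNNExtension A C D φ) C) :
    (N ⊔ Subgroup.map (HNNExtension.of : A →* HNNExtension A C D φ) C).FiniteIndex := by
  obtain ⟨d⟩ := HNNExtension.NormalWord.TransversalPair.nonempty A C D
  rw [← HNNExtension.stabilizer_halfSpace_one (d := d)] at hNC ⊢
  exact MulAction.finiteIndex_sup_stabilizer hNnorm hNfg
    (fun g => HNNExtension.smul_halfSpace_nested g 1) HNNExtension.finite_separating_halfSpace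
    ⟨_, HNNExtension.zpow_neg_smul_empty_mem_halfSpace (φ := φ) 1⟩
    ⟨_, HNNExtension.empty_notMem_halfSpace 1⟩ HNNExtension.halfSpace_one_ssubset_t_smul hNC
end

section
/- Let G = A∗_C be an HNN extension with base group A, associated subgroups C and D, and stable letter t, and let N be a normal subgroup of G. If N is finitely generated, N is not contained in C, and N ∩ C is finitely generated, then N ∩ A is finitely generated. -/
theorem Subgroup.FG.map_hom {G H : Type*} [Group G] [Group H] {P : Subgroup G} (hP : P.FG)
    (f : G →* H) : (P.map f).FG := by
  rw [Subgroup.fg_iff_submonoid_fg] at hP ⊢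
  exact hP.map f

theorem Subgroup.FG.of_map_injective {G H : Type*} [Group G] [Group H] {P : Subgroup G}
    {f : G →* H} (hf : Function.Injective f) (hP : (P.map f).FG) : P.FG := by
  rw [Subgroup.fg_iff_submonoid_fg] at hP ⊢
  exact Submonoid.FG.map_injective f hf hP

/-- If `M` has finitely generated stabilizers on `X`, and the orbit of `x₀` is connected by the
`M`-translates of finitely many edges, then `M` is finitely generated. -/
theorem Subgroup.fg_of_reflTransGen {A X : Type*} [Group A] [MulAction A X] (M : Subgroup A)
    (hstab : ∀ x : X, (M ⊓ MulAction.stabilizer A x).FG) {R : Set X} (hR : R.Finite)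
    {x₀ : X} (hx₀ : x₀ ∈ R)
    (hconn : ∀ m ∈ M, Relation.ReflTransGen
      (fun x y => ∃ n ∈ M, ∃ r ∈ R, ∃ s ∈ R, x = n • r ∧ y = n • s) x₀ (m • x₀)) :
    M.FG := by
  classical
  let τ : X → X → A := fun x y => if h : ∃ m ∈ M, m • x = y then h.choose else 1
  have hτM : ∀ x y, τ x y ∈ M := by
    intro x y
    by_cases h : ∃ m ∈ M, m • x = y
    · simp only [τ, dif_pos h]; exact h.choose_spec.1
    · simp only [τ, dif_neg h]; exact one_mem _
  have hτ : ∀ x, ∀ m ∈ M, τ x (m • x) • x = m • x := by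
    intro x m hm
    have h : ∃ n ∈ M, n • x = m • x := ⟨m, hm, rfl⟩
    simp only [τ, dif_pos h]; exact h.choose_spec.2
  let B : Subgroup A := (⨆ x ∈ R, M ⊓ MulAction.stabilizer A x) ⊔
    Subgroup.closure (Set.image2 τ R R)
  have hBfg : B.FG := by
    refine Subgroup.FG.sup (Subgroup.FG.biSup hR _ fun x _ => hstab x) ?_
    exact (Subgroup.fg_iff _).2 ⟨_, rfl, hR.image2 _ hR⟩
  have hBM : B ≤ M := by
    refine sup_le (iSup₂_le fun x _ => inf_le_left) ((Subgroup.closure_le _).2 ?_)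
    rintro _ ⟨x, _, y, _, rfl⟩
    exact hτM x y
  have htrans : ∀ x ∈ R, ∀ m ∈ M, m • x ∈ R → m ∈ B := by
    intro x hx m hm hmx
    have h1 : τ x (m • x) ∈ B :=
      (le_sup_right : _ ≤ B) (Subgroup.subset_closure ⟨x, hx, _, hmx, rfl⟩)
    have h2 : (τ x (m • x))⁻¹ * m ∈ B := by
      refine (le_sup_left : _ ≤ B)
        ((le_iSup₂_of_le x hx le_rfl : M ⊓ MulAction.stabilizer A x ≤ _) ⟨?_, ?_⟩)
      · exact M.mul_mem (M.inv_mem (hτM _ _)) hm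
      · change _ • x = x
        rw [mul_smul, inv_smul_eq_iff, hτ x m hm]
    simpa using mul_mem h1 h2
  have hW : ∀ y, Relation.ReflTransGen
      (fun x y => ∃ n ∈ M, ∃ r ∈ R, ∃ s ∈ R, x = n • r ∧ y = n • s) x₀ y →
      ∃ b ∈ B, ∃ r ∈ R, y = b • r := by
    intro y hy
    induction hy with
    | refl => exact ⟨1, one_mem _, x₀, hx₀, (one_smul _ _).symm⟩
    | tail _ h ih =>
      obtain ⟨b, hb, r, hr, rfl⟩ := ih
      obtain ⟨n, hn, r', hr', s, hs, h1, rfl⟩ := h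
      have h2 : b⁻¹ * n ∈ B := by
        refine htrans r' hr' _ (mul_mem (inv_mem (hBM hb)) hn) ?_
        rwa [mul_smul, ← h1, inv_smul_smul]
      refine ⟨n, ?_, s, hs, rfl⟩
      simpa using mul_mem hb h2
  have hMB : M ≤ B := by
    intro m hm
    obtain ⟨b, hb, r, hr, h⟩ := hW _ (hconn m hm)
    have h2 : b⁻¹ * m ∈ B := by
      refine htrans x₀ hx₀ _ (mul_mem (inv_mem (hBM hb)) hm) ?_
      rwa [mul_smul, h, inv_smul_smul]
    simpa using mul_mem hb h2
  exact le_antisymm hBM hMB ▸ hBfg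

namespace HNNExtension

open NormalWord

variable {A : Type*} [Group A] {C D : Subgroup A} (φ : C ≃* D)

/-- `StartsWith φ g u a` says that `g` is represented by a reduced word that begins with
`a * t ^ u`. -/
inductive StartsWith : HNNExtension A C D φ → ℤˣ → A → Prop
  | single (a : A) (u : ℤˣ) (b : A) : StartsWith (of a * (t ^ (u : ℤ) * of b)) u a
  | cons (a : A) (u : ℤˣ) {g : HNNExtension A C D φ} {v : ℤˣ} {b : A} (hg : StartsWith g v b)
      (h : b ∈ toSubgroup C D u → u = v) : StartsWith (of a * (t ^ (u : ℤ) * g)) u a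

variable {φ}

theorem StartsWith.of_mul {g : HNNExtension A C D φ} {u : ℤˣ} {a : A} (h : StartsWith φ g u a)
    (b : A) : StartsWith φ (of b * g) u (b * a) := by
  cases h with
  | single _ _ c => rw [← mul_assoc, ← map_mul]; exact .single _ _ _
  | cons _ _ hg h => rw [← mul_assoc, ← map_mul]; exact .cons _ _ hg h

theorem StartsWith.mul_of {g : HNNExtension A C D φ} {u : ℤˣ} {a : A} (h : StartsWith φ g u a)
    (b : A) : StartsWith φ (g * of b) u a := by
  induction h with
  | single a u c => rw [mul_assoc, mul_assoc, ← map_mul]; exact .single _ _ _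
  | cons a u hg h ih => rw [mul_assoc, mul_assoc]; exact .cons _ _ ih h

theorem StartsWith.mul_t {g : HNNExtension A C D φ} {u : ℤˣ} {a : A} (h : StartsWith φ g u a) :
    StartsWith φ (g * t) u a ∨ g * t ∈ (of : A →* HNNExtension A C D φ).range := by
  induction h with
  | single a u c =>
    by_cases hc : c ∈ toSubgroup C D u → u = 1
    · left
      have h := StartsWith.cons (φ := φ) a u (StartsWith.single c 1 1) hc
      simpa [mul_assoc] using h
    · right
      push Not at hc
      obtain ⟨hc, hu⟩ := hc
      obtain rfl : u = -1 := (Int.units_eq_one_or u).resolve_left hu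
      refine ⟨a * φ.symm ⟨c, hc⟩, ?_⟩
      rw [map_mul, equiv_symm_eq_conj]
      simp [mul_assoc]
  | cons a u hg h ih =>
    left
    rw [mul_assoc, mul_assoc]
    rcases ih with ih | ⟨b, hb⟩
    · exact .cons _ _ ih h
    · rw [← hb]; exact .single _ _ _

theorem StartsWith.exists_reducedWord {g : HNNExtension A C D φ} {u : ℤˣ} {a : A}
    (h : StartsWith φ g u a) :
    ∃ w : ReducedWord A C D, w.prod φ = g ∧ w.head = a ∧
      w.toList.head?.map Prod.fst = some u := by
  induction h with
  | single a u c => exact ⟨⟨a, [(u, c)], by simp⟩, by simp [ReducedWord.prod], rfl, rfl⟩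
  | @cons a u g v b hg h ih =>
    obtain ⟨w, rfl, rfl, hv⟩ := ih
    refine ⟨⟨a, (u, w.head) :: w.toList, List.isChain_cons.2 ⟨?_, w.chain⟩⟩, ?_, rfl, rfl⟩
    · intro y hy hw
      rw [Option.mem_def.1 hy] at hv
      simp only [Option.map_some, Option.some.injEq] at hv
      rw [hv]; exact h hw
    · simp [ReducedWord.prod, mul_assoc]

theorem StartsWith.unique {g : HNNExtension A C D φ} {u v : ℤˣ} {a b : A}
    (h : StartsWith φ g u a) (h' : StartsWith φ g v b) :
    u = v ∧ a⁻¹ * b ∈ toSubgroup C D (-u) := by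
  obtain ⟨w, hw, rfl, hu⟩ := h.exists_reducedWord
  obtain ⟨w', hw', rfl, hv⟩ := h'.exists_reducedWord
  obtain ⟨h1, h2⟩ := ReducedWord.map_fst_eq_and_of_prod_eq φ (hw.trans hw'.symm)
  refine ⟨?_, h2 u hu⟩
  rw [← List.head?_map, h1, List.head?_map, hv] at hu
  exact (Option.some.inj hu).symm

theorem StartsWith.notMem_range {g : HNNExtension A C D φ} {u : ℤˣ} {a : A}
    (h : StartsWith φ g u a) : g ∉ (of : A →* HNNExtension A C D φ).range := by
  intro hg
  obtain ⟨w, rfl, -, hu⟩ := h.exists_reducedWord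
  simp [ReducedWord.toList_eq_nil_of_mem_of_range φ w hg] at hu

theorem exists_startsWith {g : HNNExtension A C D φ}
    (hg : g ∉ (of : A →* HNNExtension A C D φ).range) : ∃ u a, StartsWith φ g u a := by
  obtain ⟨d⟩ := TransversalPair.nonempty A C D
  suffices ∀ w : NormalWord d, (w.toList = [] ∧ w.prod φ = of w.head) ∨
      ∃ u ∈ w.toList.head?.map Prod.fst, StartsWith φ (w.prod φ) u w.head by
    obtain ⟨w, rfl⟩ := (equiv φ d).symm.surjective g
    rcases this w with ⟨-, h⟩ | ⟨u, -, h⟩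
    · exact absurd ⟨_, h.symm⟩ hg
    · exact ⟨u, _, h⟩
  intro w
  induction w using consRecOn with
  | ofGroup g => left; simp [ReducedWord.prod]
  | cons g u w h1 h2 ih =>
    right
    refine ⟨u, by simp, ?_⟩
    rw [prod_cons]
    rcases ih with ⟨-, h⟩ | ⟨v, hv, h⟩
    · rw [h]; exact .single _ _ _
    · exact .cons _ _ h (h2 v hv)

/-- The edges of the Bass-Serre tree at the base vertex, together with a copy of `A`. -/
abbrev Direction (C D : Subgroup A) : Type _ := A ⊕ (Σ u : ℤˣ, A ⧸ toSubgroup C D (-u))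

open Classical in
/-- The first edge on the path in the Bass-Serre tree from the base vertex to its translate by `g`,
or `g` itself if `g ∈ A`. -/
noncomputable def direction (g : HNNExtension A C D φ) : Direction C D :=
  if h : g ∈ (of : A →* HNNExtension A C D φ).range then Sum.inl h.choose
  else Sum.inr ⟨(exists_startsWith h).choose, ((exists_startsWith h).choose_spec.choose : A)⟩

theorem direction_of (a : A) :
    direction (of a : HNNExtension A C D φ) = (Sum.inl a : Direction C D) := by
  have h : (of a : HNNExtension A C D φ) ∈ (of : A →* HNNExtension A C D φ).range := ⟨a, rfl⟩
  rw [direction, dif_pos h, of_injective φ h.choose_spec]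

theorem StartsWith.direction_eq {g : HNNExtension A C D φ} {u : ℤˣ} {a : A}
    (h : StartsWith φ g u a) :
    direction g = (Sum.inr ⟨u, (a : A ⧸ toSubgroup C D (-u))⟩ : Direction C D) := by
  have hg := h.notMem_range
  rw [direction, dif_neg hg]
  obtain ⟨h1, h2⟩ := h.unique (exists_startsWith hg).choose_spec.choose_spec
  generalize (exists_startsWith hg).choose_spec.choose = b at h2 ⊢
  generalize (exists_startsWith hg).choose = v at h1 b h2 ⊢
  subst h1
  rw [QuotientGroup.eq.2 h2]

theorem direction_of_mul (a : A) (g : HNNExtension A C D φ) :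
    direction (of a * g) = a • direction g := by
  by_cases hg : g ∈ (of : A →* HNNExtension A C D φ).range
  · obtain ⟨b, rfl⟩ := hg
    rw [← map_mul, direction_of, direction_of]; rfl
  · obtain ⟨u, b, h⟩ := exists_startsWith hg
    rw [h.direction_eq, (h.of_mul a).direction_eq]; rfl

/-- Right multiplication by `s` changes the direction of only those `g` for which one of finitely
many translates `g * p` lies in the base group. -/
theorem exists_finite_direction_mul_eq (s : HNNExtension A C D φ) :
    ∃ P : Set (HNNExtension A C D φ), P.Finite ∧ ∀ g : HNNExtension A C D φ,
      (∀ p ∈ P, g * p ∉ (of : A →* HNNExtension A C D φ).range) →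
        direction (g * s) = direction g := by
  induction s using induction_on with
  | of a =>
    refine ⟨{1}, Set.finite_singleton _, fun g hg => ?_⟩
    obtain ⟨u, b, h⟩ := exists_startsWith (by simpa using hg 1 rfl)
    rw [h.direction_eq, (h.mul_of a).direction_eq]
  | t =>
    refine ⟨{1, t}, Set.toFinite _, fun g hg => ?_⟩
    obtain ⟨u, b, h⟩ := exists_startsWith (by simpa using hg 1 (by simp))
    rw [h.direction_eq, (h.mul_t.resolve_right (hg t (by simp))).direction_eq]
  | mul x y hx hy =>
    obtain ⟨P, hP, hx⟩ := hx
    obtain ⟨Q, hQ, hy⟩ := hy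
    refine ⟨P ∪ (x * ·) '' Q, hP.union (hQ.image _), fun g hg => ?_⟩
    rw [← mul_assoc, hy, hx]
    · exact fun p hp => hg p (Or.inl hp)
    · intro p hp
      rw [mul_assoc]
      exact hg _ (Or.inr ⟨p, hp, rfl⟩)
  | inv x hx =>
    obtain ⟨P, hP, hx⟩ := hx
    refine ⟨(x⁻¹ * ·) '' P, hP.image _, fun g hg => ?_⟩
    rw [← hx (g * x⁻¹), inv_mul_cancel_right]
    intro p hp
    rw [mul_assoc]
    exact hg _ ⟨p, hp, rfl⟩

theorem fg_inf_map_toSubgroup (N : Subgroup (HNNExtension A C D φ)) [N.Normal]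
    (hN : (N ⊓ C.map of).FG) (u : ℤˣ) : (N ⊓ (toSubgroup C D u).map of).FG := by
  rcases Int.units_eq_one_or u with rfl | rfl
  · exact hN
  · convert hN.map_hom (MulAut.conj (t : HNNExtension A C D φ)).toMonoidHom using 1
    rw [Subgroup.map_inf_eq _ _ _ (MulAut.conj _).injective, Subgroup.map_map]
    congr 1
    · exact (Subgroup.Normal.map_conj_eq N t).symm
    · ext x
      simp only [Subgroup.mem_map]
      constructor
      · rintro ⟨d, hd, rfl⟩
        refine ⟨φ.symm ⟨d, hd⟩, (φ.symm ⟨d, hd⟩).2, ?_⟩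
        simp [← equiv_eq_conj]
      · rintro ⟨c, hc, rfl⟩
        exact ⟨φ ⟨c, hc⟩, (φ ⟨c, hc⟩).2, equiv_eq_conj _⟩

theorem fg_comap_inf_stabilizer_direction (N : Subgroup (HNNExtension A C D φ)) [hN : N.Normal]
    (hNC : (N ⊓ C.map of).FG) (x : Direction C D) :
    (N.comap of ⊓ MulAction.stabilizer A x).FG := by
  rcases x with a | ⟨u, q⟩
  · convert Subgroup.FG.bot
    rw [eq_bot_iff]
    rintro m ⟨-, hm⟩
    have hm : (Sum.inl (m * a) : Direction C D) = Sum.inl a := hm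
    simpa using hm
  · induction q using QuotientGroup.induction_on with
    | H a =>
      have hfg : (N.comap of ⊓ toSubgroup C D (-u)).FG := by
        apply Subgroup.FG.of_map_injective (of_injective φ)
        convert fg_inf_map_toSubgroup N hNC (-u) using 1
        ext x
        simp only [Subgroup.mem_map, Subgroup.mem_inf, Subgroup.mem_comap]
        constructor
        · rintro ⟨y, ⟨h1, h2⟩, rfl⟩; exact ⟨h1, y, h2, rfl⟩
        · rintro ⟨h1, y, h2, rfl⟩; exact ⟨y, ⟨h1, h2⟩, rfl⟩
      convert hfg.map_hom (MulAut.conj a).toMonoidHom using 1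
      ext m
      have key : m ∈ MulAction.stabilizer A
          (Sum.inr ⟨u, (a : A ⧸ toSubgroup C D (-u))⟩ : Direction C D) ↔
            a⁻¹ * m * a ∈ toSubgroup C D (-u) := by
        have h : m • (Sum.inr ⟨u, (a : A ⧸ toSubgroup C D (-u))⟩ : Direction C D) =
          Sum.inr ⟨u, ((m * a : A) : A ⧸ toSubgroup C D (-u))⟩ := rfl
        rw [MulAction.mem_stabilizer_iff, h]
        simp only [Sum.inr.injEq, Sigma.mk.injEq, heq_eq_eq, true_and]
        rw [eq_comm, QuotientGroup.eq, mul_assoc]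
      have hconj : m ∈ N.comap of ↔ a⁻¹ * m * a ∈ N.comap (of : A →* HNNExtension A C D φ) := by
        rw [(hN.comap of).mem_comm_iff, mul_inv_cancel_left]
      rw [Subgroup.mem_inf, key, hconj, Subgroup.mem_map]
      constructor
      · rintro ⟨h1, h2⟩
        exact ⟨a⁻¹ * m * a, ⟨h1, h2⟩, by simp [mul_assoc]⟩
      · rintro ⟨y, ⟨h1, h2⟩, rfl⟩
        constructor <;> simpa [mul_assoc]

theorem fg_comap_of (N : Subgroup (HNNExtension A C D φ)) (hNfg : N.FG)
    (hstab : ∀ x : Direction C D, (N.comap of ⊓ MulAction.stabilizer A x).FG) :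
    (N.comap of).FG := by
  classical
  obtain ⟨S, hSN, hS⟩ := (Subgroup.fg_iff N).1 hNfg
  choose P hPfin hP using exists_finite_direction_mul_eq (φ := φ)
  let rep : HNNExtension A C D φ → HNNExtension A C D φ := fun p =>
    if h : ∃ n ∈ N, n * p ∈ (of : A →* HNNExtension A C D φ).range then h.choose else 1
  let R : Set (Direction C D) := insert (direction (1 : HNNExtension A C D φ))
    (⋃ s ∈ S, ((fun p => direction (rep p)) '' P s ∪ (fun p => direction (rep p * s)) '' P s))
  have hR : R.Finite := (hS.biUnion fun s _ =>
    ((hPfin s).image _).union ((hPfin s).image _)).insert _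
  let r : Direction C D → Direction C D → Prop := fun x y =>
    ∃ n ∈ N.comap of, ∃ r ∈ R, ∃ s ∈ R, x = n • r ∧ y = n • s
  have hstep : ∀ g ∈ N, ∀ s ∈ S, direction (g * s) = direction g ∨
      r (direction g) (direction (g * s)) := by
    intro g hg s hs
    by_cases hp : ∀ p ∈ P s, g * p ∉ (of : A →* HNNExtension A C D φ).range
    · exact Or.inl (hP s g hp)
    · right
      push Not at hp
      obtain ⟨p, hp, hgp⟩ := hp
      have hex : ∃ n ∈ N, n * p ∈ (of : A →* HNNExtension A C D φ).range := ⟨g, hg, hgp⟩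
      have hrep : rep p ∈ N ∧ rep p * p ∈ (of : A →* HNNExtension A C D φ).range := by
        simp only [rep, dif_pos hex]; exact hex.choose_spec
      have hm : g * (rep p)⁻¹ ∈ (of : A →* HNNExtension A C D φ).range := by
        simpa [mul_assoc] using mul_mem hgp (inv_mem hrep.2)
      obtain ⟨m, hm⟩ := hm
      obtain rfl : g = of m * rep p := by rw [hm]; simp
      refine ⟨m, ?_, direction (rep p), ?_, direction (rep p * s), ?_, ?_, ?_⟩
      · rw [Subgroup.mem_comap, hm]
        exact mul_mem hg (inv_mem hrep.1)
      · exact Or.inr (Set.mem_biUnion hs (Or.inl ⟨p, hp, rfl⟩))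
      · exact Or.inr (Set.mem_biUnion hs (Or.inr ⟨p, hp, rfl⟩))
      · rw [direction_of_mul]
      · rw [mul_assoc, direction_of_mul]
  have hr : ∀ x y, r x y → r y x := by
    rintro x y ⟨n, hn, a, ha, b, hb, h1, h2⟩
    exact ⟨n, hn, b, hb, a, ha, h2, h1⟩
  have hwalk : ∀ g ∈ N, Relation.ReflTransGen r (direction (1 : HNNExtension A C D φ))
      (direction g) := by
    intro g hg
    rw [← hSN] at hg
    induction hg using Subgroup.closure_induction_right with
    | one => exact .refl
    | mul_right x hx y hy ih =>
      rcases hstep x (hSN ▸ hx) y hy with h | h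
      · rwa [h]
      · exact ih.tail h
    | mul_inv_cancel x hx y hy ih =>
      have hy' : y ∈ N := hSN ▸ Subgroup.subset_closure hy
      have hx' : x ∈ N := hSN ▸ hx
      have h := hstep (x * y⁻¹) (mul_mem hx' (inv_mem hy')) y hy
      rw [inv_mul_cancel_right] at h
      rcases h with h | h
      · rwa [← h]
      · exact ih.tail (hr _ _ h)
  refine Subgroup.fg_of_reflTransGen _ hstab hR (Set.mem_insert _ _) fun m hm => ?_
  rw [← direction_of_mul, mul_one]
  exact hwalk _ hm

end HNNExtension

/-- Let `G = A∗_C` be an HNN extension with base group `A` and associated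
subgroups `C` and `D`, and let `N` be a normal subgroup of `G`.  If `N` is finitely generated,
`N` is not contained in `C`, and `N ⊓ C` is finitely generated, then `N ⊓ A` is finitely
generated. -/
theorem stmt_5 {A : Type*} [Group A] (C D : Subgroup A) (φ : C ≃* D)
    (N : Subgroup (HNNExtension A C D φ)) (hNnorm : N.Normal) (hNfg : N.FG)
    (hNC : ¬ N ≤ Subgroup.map (HNNExtension.of : A →* HNNExtension A C D φ) C)
    (hNCfg : (N ⊓ Subgroup.map (HNNExtension.of : A →* HNNExtension A C D φ) C).FG) :
    (N ⊓ (HNNExtension.of : A →* HNNExtension A C D φ).range).FG := by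
  rw [inf_comm, ← Subgroup.map_comap_eq]
  exact (HNNExtension.fg_comap_of N hNfg
    (HNNExtension.fg_comap_inf_stabilizer_direction N hNCfg)).map_hom _
end

section
/- (Moon's theorem, HNN case.) Let G = A∗_C be an HNN extension with base group A and associated subgroups C and D, where C is a free abelian group of finite rank (C ≅ ℤⁿ for some n). Suppose that A contains no finitely generated nontrivial normal subgroup of infinite index. If N is a finitely generated normal subgroup of G with N not contained in C, then either the quotient G/N is finite or N is a free group. -/
/-- A normal subgroup acts trivially on its left cosets. -/
theorem QuotientGroup.smul_eq_self_of_mem {G : Type*} [Group G] {N : Subgroup G} [hN : N.Normal]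
    {n : G} (hn : n ∈ N) (q : G ⧸ N) : n • q = q := by
  induction q using QuotientGroup.induction_on with
  | H x =>
    rw [MulAction.Quotient.smul_coe, eq_comm, QuotientGroup.eq, smul_eq_mul, ← mul_assoc]
    exact hN.conj_mem' _ hn x

/-- If `L` has infinite index, every finite set of left cosets of `L` can be translated off
itself. -/
theorem Subgroup.exists_forall_smul_notMem {G : Type*} [Group G] {L : Subgroup G}
    (hL : ¬ L.FiniteIndex) (P : Finset (G ⧸ L)) : ∃ g : G, ∀ p ∈ P, g • p ∉ P := by
  by_contra! hcon
  have hex : ∀ x : (G ⧸ L) × (G ⧸ L), ∃ g : G, g • x.1 = x.2 :=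
    fun x => MulAction.exists_smul_eq G x.1 x.2
  choose k hk using hex
  obtain ⟨x, -, hx⟩ := Subgroup.exists_finiteIndex_of_leftCoset_cover (s := P ×ˢ P) (g := k)
    (H := fun x => MulAction.stabilizer G x.1) (by
      refine Set.eq_univ_of_forall fun g => ?_
      obtain ⟨p, hp, hgp⟩ := hcon g
      refine Set.mem_iUnion₂.2 ⟨(p, g • p), Finset.mk_mem_product hp hgp, ?_⟩
      rw [Set.mem_smul_set_iff_inv_smul_mem, smul_eq_mul, SetLike.mem_coe,
        MulAction.mem_stabilizer_iff, mul_smul, inv_smul_eq_iff, hk])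
  apply hL
  constructor
  have := hx.index_ne_zero
  rwa [MulAction.index_stabilizer_of_transitive] at this

/-- If a normal subgroup `N` of a group acting transitively on `X` fixes a finitely supported
function `X → ℤ` of total mass one, then `N` acts trivially on `X`. -/
theorem smul_eq_self_of_invariant_finsupp {G X : Type*} [Group G] [MulAction G X]
    [MulAction.IsPretransitive G X] (N : Subgroup G) [N.Normal] (w : X →₀ ℤ)
    (hw : ∀ n ∈ N, ∀ x, w (n • x) = w x) (hsum : w.sum (fun _ z => z) = 1)
    {n : G} (hn : n ∈ N) (x : X) : n • x = x := by
  classical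
  have hcard : ∀ y : X, (MulAction.orbit N y).ncard = (MulAction.orbit N x).ncard := by
    intro y
    obtain ⟨g, rfl⟩ := MulAction.exists_smul_eq G x y
    rw [← MulAction.smul_orbit_eq_orbit_smul, Set.ncard_smul_set]
  have hw' : ∀ y z, y ∈ MulAction.orbit N z → w y = w z := by
    rintro _ z ⟨m, rfl⟩
    exact hw m m.2 z
  have hdvd : ((MulAction.orbit N x).ncard : ℤ) ∣ 1 := by
    rw [← hsum, Finsupp.sum, ← Finset.sum_fiberwise_of_maps_to
      (t := w.support.image (Quotient.mk (MulAction.orbitRel N X)))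
      (fun y hy => Finset.mem_image_of_mem _ hy)]
    refine Finset.dvd_sum fun c hc => ?_
    obtain ⟨z, hz, rfl⟩ := Finset.mem_image.1 hc
    have hset : (({y ∈ w.support | Quotient.mk (MulAction.orbitRel N X) y = Quotient.mk _ z} :
        Finset X) : Set X) = MulAction.orbit N z := by
      ext y
      simp only [Finset.coe_filter, Set.mem_ofPred_eq, Quotient.eq]
      rw [MulAction.orbitRel_apply, and_iff_right_iff_imp]
      intro hy
      rw [Finsupp.mem_support_iff, hw' y z hy]
      exact Finsupp.mem_support_iff.1 hz
    have hconst : ∀ y ∈ ({y ∈ w.support |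
        Quotient.mk (MulAction.orbitRel N X) y = Quotient.mk _ z} : Finset X), w y = w z := fun y hy => hw' y z (by rw [← hset]; exact hy)
    rw [Finset.sum_congr rfl hconst, Finset.sum_const, ← Set.ncard_coe_finset, hset, hcard z,
      nsmul_eq_mul]
    exact dvd_mul_right (_ : ℤ) _
  have hone : (MulAction.orbit N x).ncard = 1 := by
    have := Int.natCast_dvd_natCast.1
      (by simpa using hdvd : ((MulAction.orbit N x).ncard : ℤ) ∣ (1 : ℕ))
    exact Nat.dvd_one.1 this
  obtain ⟨y, hy⟩ := Set.ncard_eq_one.1 hone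
  have h1 : n • x ∈ MulAction.orbit N x := ⟨⟨n, hn⟩, rfl⟩
  have h2 : x ∈ MulAction.orbit N x := MulAction.mem_orbit_self x
  rw [hy] at h1 h2
  exact h1.trans h2.symm

/-- If `H ⊔ N` has finite index, there are finitely many double cosets of `H` and `N`; the function
`r` picks their representatives. -/
theorem Subgroup.exists_doubleCoset_transversal {G : Type*} [Group G] (H N : Subgroup G)
    [hN : N.Normal] [(H ⊔ N).FiniteIndex] :
    ∃ (r : G → G) (d : G → H), (Set.range r).Finite ∧ (∀ x, (r x)⁻¹ * ((d x : G)⁻¹ * x) ∈ N) ∧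
      (∀ h ∈ H, ∀ x, r (h * x) = r x) ∧ ∀ n ∈ N, ∀ x, r (x * n) = r x := by
  let r : G → G := fun x => (QuotientGroup.mk x⁻¹ : G ⧸ (H ⊔ N)).out⁻¹
  have hl : ∀ l ∈ H ⊔ N, ∀ x, r (l * x) = r x := by
    intro l hl x
    simp only [r]
    congr 2
    rw [QuotientGroup.eq]
    simpa using hl
  have hd : ∀ x, ∃ d : H, (r x)⁻¹ * ((d : G)⁻¹ * x) ∈ N := by
    intro x
    obtain ⟨⟨l, hl⟩, hxl⟩ := QuotientGroup.mk_out_eq_mul (H ⊔ N) x⁻¹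
    obtain ⟨d, hd, n, hn, rfl⟩ := Subgroup.mem_sup_of_normal_right.1 hl
    refine ⟨⟨d, hd⟩, ?_⟩
    simp only [r, hxl, inv_inv]
    have := hN.conj_mem _ (hN.conj_mem _ hn d) x⁻¹
    simpa [mul_assoc] using this
  choose d hd using hd
  refine ⟨r, d, ?_, hd, fun h hh => hl h (Subgroup.mem_sup_left hh), fun n hn x => ?_⟩
  · exact (Set.finite_range fun q : G ⧸ (H ⊔ N) => q.out⁻¹).subset
      (Set.range_subset_iff.2 fun x => ⟨_, rfl⟩)
  · have := hl (x * n * x⁻¹) (Subgroup.mem_sup_right (hN.conj_mem _ hn x)) x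
    simpa using this

/-- Subgroups of a free abelian group of finite rank are finitely generated. -/
theorem Subgroup.fg_of_mulEquiv_pi_int {G : Type*} [Group G] {C : Subgroup G} {n : ℕ}
    (e : C ≃* Multiplicative (Fin n → ℤ)) {E : Subgroup G} (hE : E ≤ C) : E.FG := by
  let f : Multiplicative (Fin n → ℤ) →* G := C.subtype.comp e.symm.toMonoidHom
  have hf : f.range = C := by
    rw [MonoidHom.range_comp, MonoidHom.range_eq_top.2 e.symm.surjective,
      ← MonoidHom.range_eq_map, Subgroup.range_subtype]
  obtain ⟨T, hT⟩ : (Subgroup.toAddSubgroup' (E.comap f)).FG :=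
    (Submodule.fg_iff_addSubgroup_fg _).1 (IsNoetherian.noetherian
      (AddSubgroup.toIntSubmodule (Subgroup.toAddSubgroup' (E.comap f))))
  have hT' : Subgroup.closure (Multiplicative.toAdd ⁻¹' (T : Set (Fin n → ℤ))) = E.comap f :=
    Subgroup.toAddSubgroup'.injective ((Subgroup.toAddSubgroup'_closure _).trans hT)
  refine (Subgroup.fg_iff E).2 ⟨f '' (Multiplicative.toAdd ⁻¹' (T : Set (Fin n → ℤ))), ?_, ?_⟩
  · rw [← MonoidHom.map_closure, hT', Subgroup.map_comap_eq_self (hE.trans_eq hf.symm)]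
  · exact (T.finite_toSet.preimage Multiplicative.toAdd.injective.injOn).image f

namespace HNNExtension

variable {A : Type*} [Group A] {C D : Subgroup A} {φ : C ≃* D}

/-- A crossed homomorphism on an HNN extension that is trivial on the base group is determined by
its value at the stable letter, which may be any element fixed by the second associated
subgroup. -/
theorem exists_crossedHom {M : Type*} [Group M] (ψ : HNNExtension A C D φ →* MulAut M) (m : M)
    (hm : ∀ d : D, ψ (of (d : A)) m = m) :
    ∃ δ : HNNExtension A C D φ → M, (∀ g h, δ (g * h) = δ g * ψ g (δ h)) ∧
      (∀ a, δ (of a) = 1) ∧ δ t = m := by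
  let F : HNNExtension A C D φ →* M ⋊[ψ] HNNExtension A C D φ :=
    lift (SemidirectProduct.inr.comp of) ⟨m, t⟩ (by
      intro c
      ext
      · simp [hm]
      · simp [t_mul_of])
  have hF : ∀ g, (F g).right = g := by
    have : SemidirectProduct.rightHom.comp F = MonoidHom.id _ := by
      ext <;> simp [F]
    exact fun g => DFunLike.congr_fun this g
  refine ⟨fun g => (F g).left, fun g h => ?_, fun a => ?_, ?_⟩
  · simp [hF]
  · simp [F]
  · simp [F]

/-- Crossed homomorphisms are determined by their values on the base group and the stable
letter. -/
theorem crossedHom_ext {M : Type*} [Group M] {ψ : HNNExtension A C D φ →* MulAut M}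
    {δ ε : HNNExtension A C D φ → M} (hδ : ∀ g h, δ (g * h) = δ g * ψ g (δ h))
    (hε : ∀ g h, ε (g * h) = ε g * ψ g (ε h)) (hof : ∀ a, δ (of a) = ε (of a))
    (ht : δ t = ε t) : δ = ε := by
  have h1 : δ 1 = ε 1 := by simpa using hof 1
  ext g
  induction g using induction_on with
  | of a => exact hof a
  | t => exact ht
  | mul x y hx hy => rw [hδ, hε, hx, hy]
  | inv x hx =>
    have h := hδ x x⁻¹
    have h' := hε x x⁻¹
    rw [mul_inv_cancel] at h h'
    rw [h, h', hx] at h1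
    exact (ψ x).injective (mul_left_cancel h1)

/-- A normal subgroup meeting the base group trivially is free. -/
theorem isFreeGroup_of_comap_eq_bot (N : Subgroup (HNNExtension A C D φ)) [hN : N.Normal]
    (h : N.comap (of : A →* HNNExtension A C D φ) = ⊥) : IsFreeGroup N := by
  let G := HNNExtension A C D φ
  obtain ⟨p, hp, hpa⟩ : ∃ p : G ⧸ N → G, (∀ q, (p q : G ⧸ N) = q) ∧
      ∀ (a : A) q, p ((of a : G) • q) = of a * p q := by
    let r : Setoid (G ⧸ N) := MulAction.orbitRel (of : A →* G).range (G ⧸ N)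
    have hex : ∀ q : G ⧸ N, ∃ a : A, (of a : G) • (Quotient.mk r q).out = q := by
      intro q
      have : r q (Quotient.mk r q).out := r.symm (Quotient.mk_out q)
      obtain ⟨⟨_, a, rfl⟩, ha⟩ := MulAction.orbitRel_apply.1 this
      exact ⟨a, ha⟩
    choose b hb using hex
    have hinj : ∀ (a a' : A) (q : G ⧸ N), (of a : G) • q = (of a' : G) • q → a = a' := by
      intro a a' q haq
      induction q using QuotientGroup.induction_on with
      | H x =>
        have h1 : x⁻¹ * (of (a⁻¹ * a')) * x ∈ N := by
          have := QuotientGroup.eq.1 haq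
          simpa only [smul_eq_mul, mul_inv_rev, map_mul, map_inv, mul_assoc] using this
        have h2 : a⁻¹ * a' ∈ N.comap (of : A →* G) := by
          have := hN.conj_mem _ h1 x
          simpa [mul_assoc] using this
        rw [h, Subgroup.mem_bot] at h2
        exact (inv_mul_eq_one.1 h2)
    refine ⟨fun q => of (b q) * (Quotient.mk r q).out.out, fun q => ?_, fun a q => ?_⟩
    · conv_rhs => rw [← hb q, ← QuotientGroup.out_eq' (Quotient.mk r q).out]
      rfl
    · have hq : Quotient.mk r ((of a : G) • q) = Quotient.mk r q :=
        Quotient.sound (MulAction.orbitRel_apply.2 ⟨⟨of a, a, rfl⟩, rfl⟩)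
      have : b ((of a : G) • q) = a * b q := by
        apply hinj _ _ (Quotient.mk r q).out
        rw [map_mul, mul_smul, hb, ← hq, hb]
      simp only [this, hq, map_mul, mul_assoc]
  have hmem : ∀ (g : G) (q : G ⧸ N), (p q)⁻¹ * g * p (g⁻¹ • q) ∈ N := by
    intro g q
    rw [mul_assoc, ← QuotientGroup.eq, hp]
    change q = g • (p (g⁻¹ • q) : G ⧸ N)
    rw [hp, smul_inv_smul]
  let κ : G → (G ⧸ N → N) := fun g q => ⟨(p q)⁻¹ * g * p (g⁻¹ • q), hmem g q⟩
  obtain ⟨δ, hδ, hδa, hδt⟩ := exists_crossedHom (φ := φ) (M := G ⧸ N → FreeGroup N)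
    mulAutArrow (fun q => FreeGroup.of (κ t q)) (by
      intro d
      funext q
      have ht : (t⁻¹ * of ((d⁻¹ : D) : A) : G) = of (φ.symm d⁻¹ : A) * t⁻¹ := inv_t_mul_of _
      change FreeGroup.of (κ t ((of (d : A))⁻¹ • q)) = _
      congr 1
      ext
      have hd : (of (d : A) : G)⁻¹ = of ((d⁻¹ : D) : A) := by simp
      simp only [κ]
      rw [hd, ← mul_smul, ht, mul_smul, hpa, hpa, mul_inv_rev, ← map_inv]
      rw [← mul_assoc, mul_assoc _ t, ← of_mul_t]
      simp [mul_assoc])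
  have hκ : (fun g q => FreeGroup.lift id (δ g q)) = κ := by
    apply crossedHom_ext (φ := φ) (ψ := mulAutArrow)
    · intro g h
      funext q
      simp [hδ]
      rfl
    · intro g h
      funext q
      ext
      change _ = (p q)⁻¹ * g * p (g⁻¹ • q) * ((p (g⁻¹ • q))⁻¹ * h * p (h⁻¹ • g⁻¹ • q))
      simp only [κ, mul_inv_rev, mul_smul, mul_assoc, mul_inv_cancel_left]
    · intro a
      funext q
      ext
      simp only [κ, ← map_inv, hpa]
      simp [hδa]
    · funext q
      simp [hδt]
  let f : N →* FreeGroup N :=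
    { toFun := fun n => δ n (1 : G)
      map_one' := by simpa using congrFun (hδa 1) ((1 : G) : G ⧸ N)
      map_mul' := by
        intro n m
        simp only [Subgroup.coe_mul, hδ, Pi.mul_apply]
        congr 1
        change δ m ((n : G)⁻¹ • _) = _
        rw [QuotientGroup.smul_eq_self_of_mem (N.inv_mem n.2)] }
  have hf : Function.Injective f := by
    intro n m hnm
    have hk : ∀ n : N, (FreeGroup.lift id (f n) : N) =
        (p (1 : G))⁻¹ * (n : G) * p (1 : G) := by
      intro n
      have := congrFun (congrFun hκ n) ((1 : G) : G ⧸ N)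
      change FreeGroup.lift id (f n) = _ at this
      rw [this]
      simp only [κ]
      rw [QuotientGroup.smul_eq_self_of_mem (N.inv_mem n.2)]
    have := (hk n).symm.trans (
      (congrArg (fun z => ((FreeGroup.lift id z : N) : G)) hnm).trans (hk m))
    ext
    simpa using this
  exact IsFreeGroup.ofMulEquiv (MonoidHom.ofInjective hf).symm

/-- The chain of edges of the Bass–Serre tree crossed by the path joining the base vertex to its
translate. -/
theorem exists_edgeChain (φ : C ≃* D) :
    ∃ δ : HNNExtension A C D φ →
        (HNNExtension A C D φ ⧸ D.map (of : A →* HNNExtension A C D φ) →₀ ℤ),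
      (∀ g h, δ (g * h) = δ g + (δ h).mapDomain (g • ·)) ∧ (∀ a, δ (of a) = 0) ∧
      δ t = Finsupp.single ((1 : HNNExtension A C D φ) : HNNExtension A C D φ ⧸ _) 1 := by
  let := Finsupp.comapDistribMulAction (G := HNNExtension A C D φ)
    (α := HNNExtension A C D φ ⧸ D.map (of : A →* HNNExtension A C D φ)) (M := ℤ)
  obtain ⟨δ, h1, h2, h3⟩ := exists_crossedHom (φ := φ)
    ((MulAutMultiplicative _).symm.toMonoidHom.comp
      (DistribMulAction.toAddAut (HNNExtension A C D φ)
        (HNNExtension A C D φ ⧸ D.map (of : A →* HNNExtension A C D φ) →₀ ℤ)))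
    (Multiplicative.ofAdd
      (Finsupp.single ((1 : HNNExtension A C D φ) : HNNExtension A C D φ ⧸ _) 1)) (by
      intro d
      change Multiplicative.ofAdd (Finsupp.mapDomain _ _) = _
      rw [toAdd_ofAdd, Finsupp.mapDomain_single]
      congr 2
      rw [MulAction.Quotient.smul_coe, eq_comm, QuotientGroup.eq]
      simp
      exact ⟨d, d.2, rfl⟩)
  exact ⟨fun g => (δ g).toAdd, h1, h2, congrArg Multiplicative.toAdd h3⟩

theorem le_map_of_of_le_range (N : Subgroup (HNNExtension A C D φ)) [hN : N.Normal]
    (h : N ≤ (of : A →* HNNExtension A C D φ).range) :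
    N ≤ C.map (of : A →* HNNExtension A C D φ) := by
  obtain ⟨δ, hδ, hδa, hδt⟩ := exists_edgeChain φ
  intro n hn
  obtain ⟨b, rfl⟩ := h hn
  obtain ⟨a, ha⟩ := h (hN.conj_mem _ hn t)
  have hat : of a * t = (t : HNNExtension A C D φ) * of b := by rw [ha]; simp
  have hδat := congrArg δ hat
  rw [hδ, hδ, hδa, hδa, hδt, Finsupp.mapDomain_zero, add_zero, zero_add, Finsupp.mapDomain_single,
    Finsupp.single_left_inj one_ne_zero, MulAction.Quotient.smul_coe, eq_comm,
    QuotientGroup.eq] at hδat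
  obtain ⟨d, hd, hda⟩ := hδat
  have had : a = d := by
    apply of_injective (φ := φ)
    simpa using hda.symm
  subst had
  refine ⟨φ.symm ⟨a, hd⟩, (φ.symm ⟨a, hd⟩).2, ?_⟩
  have := of_mul_t (φ := φ) ⟨a, hd⟩
  exact (mul_left_cancel (hat.symm.trans this)).symm

/-- A finitely generated normal subgroup not contained in the associated subgroups has finitely
many orbits of edges on the Bass–Serre tree. -/
theorem finiteIndex_map_of_sup_of_fg (N : Subgroup (HNNExtension A C D φ)) [hN : N.Normal]
    (hfg : N.FG) (hNC : ¬ N ≤ C.map (of : A →* HNNExtension A C D φ)) :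
    (D.map (of : A →* HNNExtension A C D φ) ⊔ N).FiniteIndex := by
  classical
  by_contra hL
  let D' := D.map (of : A →* HNNExtension A C D φ)
  obtain ⟨δ, hδ, hδa, hδt⟩ : ∃ δ : HNNExtension A C D φ → (HNNExtension A C D φ ⧸ D' →₀ ℤ),
      (∀ g h, δ (g * h) = δ g + (δ h).mapDomain (g • ·)) ∧ (∀ a, δ (of a) = 0) ∧
      δ t = Finsupp.single ((1 : HNNExtension A C D φ) : HNNExtension A C D φ ⧸ D') 1 :=
    exists_edgeChain φ
  let A' := (of : A →* HNNExtension A C D φ).range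
  have hδ' : ∀ g h e, δ (g * h) e = δ g e + δ h (g⁻¹ • e) := by
    intro g h e
    conv_lhs => rw [← smul_inv_smul g e]
    rw [hδ, Finsupp.add_apply, Finsupp.mapDomain_apply (MulAction.injective g), smul_inv_smul]
  have hδ1 : δ 1 = 0 := by simpa using hδa 1
  let π : HNNExtension A C D φ ⧸ D' → HNNExtension A C D φ ⧸ (D' ⊔ N) :=
    Subgroup.quotientMapOfLE le_sup_left
  have hπ : ∀ (g : HNNExtension A C D φ) e, π (g • e) = g • π e := by
    intro g e
    induction e using QuotientGroup.induction_on
    rfl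
  have hπN : ∀ n ∈ N, ∀ e, π (n • e) = π e := by
    intro n hn e
    induction e using QuotientGroup.induction_on with
    | H x =>
      rw [MulAction.Quotient.smul_coe]
      refine QuotientGroup.eq.2 (Subgroup.mem_sup_right ?_)
      have := hN.conj_mem _ (N.inv_mem hn) x⁻¹
      simpa [mul_assoc] using this
  obtain ⟨S, hS⟩ := hfg
  let P : Finset (HNNExtension A C D φ ⧸ (D' ⊔ N)) := S.biUnion fun s => (δ s).support.image π
  have hsupp : ∀ n ∈ N, ∀ e, π e ∉ P → δ n e = 0 := by
    intro n hn
    rw [← hS] at hn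
    induction hn using Subgroup.closure_induction with
    | mem s hs =>
      intro e he
      by_contra hne
      exact he (Finset.mem_biUnion.2 ⟨s, hs,
        Finset.mem_image_of_mem _ (Finsupp.mem_support_iff.2 hne)⟩)
    | one => simp [hδ1]
    | mul x y hx hy ihx ihy =>
      rw [hS] at hx
      intro e he
      rw [hδ', ihx e he, ihy _ (by rwa [hπN _ (N.inv_mem hx)]), add_zero]
    | inv x hx ihx =>
      rw [hS] at hx
      intro e he
      have h := hδ' x⁻¹ x e
      rw [inv_mul_cancel, hδ1, inv_inv, ihx _ (by rwa [hπN _ hx])] at h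
      simpa using h.symm
  obtain ⟨g, hg⟩ := Subgroup.exists_forall_smul_notMem hL P
  let u := (δ g).filter (fun e => π e ∈ P)
  have hup : ∀ e, π e ∈ P → u e = δ g e :=
    fun e he => Finsupp.filter_apply_pos (fun e => π e ∈ P) _ he
  have hun : ∀ e, π e ∉ P → u e = 0 :=
    fun e he => Finsupp.filter_apply_neg (fun e => π e ∈ P) _ he
  have hu : ∀ n ∈ N, δ n = u - u.mapDomain (n • ·) := by
    intro n hn
    ext e
    have hue : u.mapDomain (n • ·) e = u (n⁻¹ • e) := by
      conv_lhs => rw [← smul_inv_smul n e]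
      rw [Finsupp.mapDomain_apply (MulAction.injective n)]
    rw [Finsupp.sub_apply, hue]
    by_cases he : π e ∈ P
    · have he' : π (n⁻¹ • e) ∈ P := by rwa [hπN _ (N.inv_mem hn)]
      rw [hup _ he, hup _ he']
      have h1 := hδ' g (g⁻¹ * n * g) e
      have h2 := hδ' n g e
      rw [hsupp (g⁻¹ * n * g) (by simpa using hN.conj_mem _ hn g⁻¹)] at h1
      · rw [show g * (g⁻¹ * n * g) = n * g by group] at h1
        linarith
      · intro hmem
        apply hg _ hmem
        rwa [hπ, smul_inv_smul]
    · have he' : π (n⁻¹ • e) ∉ P := by rwa [hπN _ (N.inv_mem hn)]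
      rw [hun _ he, hun _ he', hsupp n hn e he,
        sub_zero]
  have hle : D' ≤ A' := Subgroup.map_le_range _ _
  let j₀ : HNNExtension A C D φ ⧸ D' → HNNExtension A C D φ ⧸ A' :=
    Subgroup.quotientMapOfLE hle
  let j₁ : HNNExtension A C D φ ⧸ D' → HNNExtension A C D φ ⧸ A' :=
    Quotient.map' (· * t) (by
      intro x y hxy
      rw [QuotientGroup.leftRel_apply] at hxy ⊢
      obtain ⟨d, hd, hdx⟩ := hxy
      refine ⟨φ.symm ⟨d, hd⟩, ?_⟩
      rw [equiv_symm_eq_conj, hdx]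
      simp [mul_assoc])
  have hj₀ : ∀ (g : HNNExtension A C D φ) e, j₀ (g • e) = g • j₀ e := by
    intro g e
    induction e using QuotientGroup.induction_on
    rfl
  have hj₁ : ∀ (g : HNNExtension A C D φ) e, j₁ (g • e) = g • j₁ e := by
    intro g e
    induction e using QuotientGroup.induction_on with
    | H x => exact congrArg _ (mul_assoc g x t)
  let bd : (HNNExtension A C D φ ⧸ D' →₀ ℤ) →+ (HNNExtension A C D φ ⧸ A' →₀ ℤ) :=
    Finsupp.mapDomain.addMonoidHom j₁ - Finsupp.mapDomain.addMonoidHom j₀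
  have hbd : ∀ v, bd v = v.mapDomain j₁ - v.mapDomain j₀ := fun v => rfl
  have hbd_smul : ∀ (g : HNNExtension A C D φ) v,
      bd (v.mapDomain (g • ·)) = (bd v).mapDomain (g • ·) := by
    intro g v
    change _ = Finsupp.mapDomain.addMonoidHom (g • ·) (bd v)
    rw [hbd, hbd, map_sub]
    simp only [Finsupp.mapDomain.addMonoidHom_apply, ← Finsupp.mapDomain_comp]
    congr 2 <;> funext e
    · exact hj₁ g e
    · exact hj₀ g e
  have hbdδ : ∀ g, bd (δ g) = Finsupp.single (g : HNNExtension A C D φ ⧸ A') 1 -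
      Finsupp.single ((1 : HNNExtension A C D φ) : HNNExtension A C D φ ⧸ A') 1 := by
    have hmul : ∀ x y, bd (δ (x * y)) =
        bd (δ x) + Finsupp.mapDomain.addMonoidHom (x • ·) (bd (δ y)) := by
      intro x y
      rw [hδ, map_add, hbd_smul]
      rfl
    have hsingle : ∀ x y : HNNExtension A C D φ,
        Finsupp.mapDomain.addMonoidHom (x • ·)
          (Finsupp.single (y : HNNExtension A C D φ ⧸ A') (1 : ℤ)) =
          Finsupp.single ((x * y : HNNExtension A C D φ) : HNNExtension A C D φ ⧸ A') 1 :=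
      fun x y => Finsupp.mapDomain_single
    intro g
    induction g using induction_on with
    | of a =>
      rw [hδa, map_zero, eq_comm, sub_eq_zero]
      congr 1
      rw [QuotientGroup.eq]
      exact A'.mul_mem (A'.inv_mem ⟨a, rfl⟩) A'.one_mem
    | t =>
      rw [hδt, hbd, Finsupp.mapDomain_single, Finsupp.mapDomain_single]
      congr 2
    | mul x y hx hy =>
      rw [hmul, hx, hy, map_sub, hsingle, hsingle, mul_one]
      abel
    | inv x hx =>
      have h := hmul x⁻¹ x
      rw [inv_mul_cancel, hδ1, map_zero, hx, map_sub, hsingle, hsingle, inv_mul_cancel,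
        mul_one] at h
      exact (eq_neg_of_add_eq_zero_left h.symm).trans (neg_sub _ _)
  let w := Finsupp.single ((1 : HNNExtension A C D φ) : HNNExtension A C D φ ⧸ A') 1 + bd u
  have hw : ∀ n ∈ N, w.mapDomain (n • ·) = w := by
    intro n hn
    have h := hbdδ n
    rw [hu n hn, map_sub, hbd_smul] at h
    simp only [w]
    rw [Finsupp.mapDomain_add, Finsupp.mapDomain_single, MulAction.Quotient.smul_coe, smul_eq_mul,
      mul_one]
    rw [sub_eq_sub_iff_add_eq_add] at h
    rw [← h, add_comm]
  apply hNC
  apply le_map_of_of_le_range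
  intro n hn
  have hfix := smul_eq_self_of_invariant_finsupp N w (fun n hn x => by
      conv_lhs => rw [← hw n hn]
      rw [Finsupp.mapDomain_apply (MulAction.injective n)]) (by
      have : ∀ v : HNNExtension A C D φ ⧸ A' →₀ ℤ,
          v.sum (fun _ z => z) = Finsupp.linearCombination ℤ (fun _ => (1 : ℤ)) v := by
        intro v
        simp [Finsupp.linearCombination_apply]
      rw [this]
      simp only [w, hbd, map_add, map_sub, Finsupp.linearCombination_mapDomain]
      simp [Function.comp_def]) hn ((1 : HNNExtension A C D φ) : HNNExtension A C D φ ⧸ A')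
  rw [MulAction.Quotient.smul_coe, eq_comm, QuotientGroup.eq] at hfix
  have hnA : n ∈ A' := by simpa using hfix
  exact hnA

/-- A function on `G` whose coboundary at the stable letter agrees, on a set `Y`, with a function
invariant under the second associated subgroup gives a crossed homomorphism that vanishes at the
stable letter on `Y`. -/
theorem exists_crossedHom_eq_zero (σ h : HNNExtension A C D φ → ℤ)
    (hinv : ∀ d ∈ D, ∀ x, h (of d * x) = h x) :
    ∃ δ : HNNExtension A C D φ → HNNExtension A C D φ → ℤ,
      (∀ g k x, δ (g * k) x = δ g x + δ k (g⁻¹ * x)) ∧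
      (∀ a x, δ (of a) x = σ x - σ ((of a)⁻¹ * x)) ∧
      ∀ x, h x = σ (t⁻¹ * x) - σ x → δ t x = 0 := by
  obtain ⟨δ, hδ, hδa, hδt⟩ := exists_crossedHom (φ := φ)
    (M := HNNExtension A C D φ → Multiplicative ℤ) mulAutArrow
    (fun x => Multiplicative.ofAdd (h x)) (by
      intro d
      funext x
      change Multiplicative.ofAdd (h ((of (d : A))⁻¹ * x)) = _
      rw [← map_inv, hinv _ (D.inv_mem d.2)])
  refine ⟨fun g x => (δ g x).toAdd + σ x - σ (g⁻¹ * x), fun g k x => ?_, fun a x => ?_,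
    fun x hx => ?_⟩
  · have : (δ (g * k) x).toAdd = (δ g x).toAdd + (δ k (g⁻¹ * x)).toAdd := by
      rw [hδ]
      rfl
    simp only [this, mul_inv_rev, mul_assoc]
    ring
  · simp [hδa]
  · simp [hδt, hx]

open Filter in
/-- If a finitely generated normal subgroup has finitely many orbits of edges on the Bass–Serre
tree, and edge stabilizers are Noetherian, then it meets the base group in a finitely generated
subgroup. -/
theorem comap_of_fg (N : Subgroup (HNNExtension A C D φ)) [hN : N.Normal] (hfg : N.FG)
    [(D.map (of : A →* HNNExtension A C D φ) ⊔ N).FiniteIndex]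
    (hC : ∀ E ≤ C, E.FG) (hD : ∀ E ≤ D, E.FG) :
    (N.comap (of : A →* HNNExtension A C D φ)).FG := by
  classical
  let G := HNNExtension A C D φ
  let K := N.comap (of : A →* G)
  obtain ⟨r, d, hrfin, hd, hrD, hrN⟩ :=
    Subgroup.exists_doubleCoset_transversal (D.map (of : A →* G)) N
  let s : A → A := fun a => (a : A ⧸ K).out
  have hs : ∀ a a', a⁻¹ * a' ∈ K → s a = s a' :=
    fun a a' h => congrArg Quotient.out (QuotientGroup.eq.2 h)
  have hsK : ∀ a, a⁻¹ * s a ∈ K := fun a =>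
    QuotientGroup.eq.1 (QuotientGroup.out_eq' (a : A ⧸ K)).symm
  let B : Finset K → Subgroup A := fun F => Subgroup.closure (Subtype.val '' (F : Set K))
  let S : Finset K → G → Prop := fun F x => ∃ a, of a = x ∧ (s a)⁻¹ * a ∈ B F
  have hB : ∀ k ∈ K, ∀ᶠ F in atTop, k ∈ B F := by
    intro k hk
    filter_upwards [eventually_ge_atTop {⟨k, hk⟩}] with F hF
    exact Subgroup.subset_closure ⟨⟨k, hk⟩, hF (Finset.mem_singleton_self _), rfl⟩
  have hS : ∀ F a, S F (of a) ↔ (s a)⁻¹ * a ∈ B F := by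
    refine fun F a => ⟨?_, fun h => ⟨a, rfl, h⟩⟩
    rintro ⟨a', ha', h⟩
    rwa [of_injective (φ := φ) ha'] at h
  have hS' : ∀ F x, x ∉ (of : A →* G).range → ¬ S F x := by
    rintro F _ hx ⟨a, rfl, -⟩
    exact hx ⟨a, rfl⟩
  have hshift : ∀ (a : A) (x : G), ∀ᶠ F in atTop, ∀ n ∈ N, S F (of a * x * n) ↔ S F (x * n) := by
    intro a x
    by_cases hx : ∃ a' : A, x⁻¹ * of a' ∈ N
    · obtain ⟨a', ha'⟩ := hx
      have hf : (s (a * a'))⁻¹ * a * s a' ∈ K := by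
        have := K.mul_mem (K.inv_mem (hsK (a * a'))) (hsK a')
        simpa [mul_assoc] using this
      filter_upwards [hB _ hf] with F hF n hn
      by_cases hxn : x * n ∈ (of : A →* G).range
      · obtain ⟨b, hb⟩ := hxn
        have hb' : a'⁻¹ * b ∈ K := by
          have := N.mul_mem (N.inv_mem ha') hn
          change of (a'⁻¹ * b) ∈ N
          rw [map_mul, hb]
          simpa [mul_assoc] using this
        rw [mul_assoc, ← hb, ← map_mul, hS, hS, ← hs a' b hb',
          ← hs (a * a') (a * b) (by simpa [mul_assoc] using hb')]
        rw [← (B F).mul_mem_cancel_left hF (y := (s a')⁻¹ * b)]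
        simp [mul_assoc]
      · refine iff_of_false (hS' _ _ fun h => hxn ?_) (hS' _ _ hxn)
        rwa [mul_assoc, Subgroup.mul_mem_cancel_left _ (MonoidHom.mem_range.2 ⟨a, rfl⟩)] at h
    · refine Eventually.of_forall fun F n hn => ?_
      have hxn : x * n ∉ (of : A →* G).range := by
        rintro ⟨b, hb⟩
        exact hx ⟨b, by simpa [hb] using hn⟩
      refine iff_of_false (hS' _ _ fun h => hxn ?_) (hS' _ _ hxn)
      rwa [mul_assoc, Subgroup.mul_mem_cancel_left _ (MonoidHom.mem_range.2 ⟨a, rfl⟩)] at h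
  have hshiftE : ∀ E : Subgroup A, E.FG → E ≤ K → ∀ x : G, ∀ᶠ F in atTop,
      ∀ e ∈ E, ∀ n ∈ N, S F (of e * x * n) ↔ S F (x * n) := by
    rintro E ⟨T, rfl⟩ hE x
    have hT : ∀ᶠ F in atTop, ∀ e ∈ T, ∀ n ∈ N, S F (of e * x * n) ↔ S F (x * n) :=
      (Finset.eventually_all T).2 fun e _ => hshift e x
    filter_upwards [hT] with F hF e he
    have hconj : ∀ e ∈ Subgroup.closure (T : Set A), x⁻¹ * of e * x ∈ N := fun e he => by
      simpa using hN.conj_mem _ (hE he) x⁻¹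
    induction he using Subgroup.closure_induction with
    | mem e he => exact hF e he
    | one => simp
    | mul e f he hf ihe ihf =>
      intro n hn
      rw [← ihf n hn, map_mul]
      convert ihe (x⁻¹ * of f * x * n) (N.mul_mem (hconj f hf) hn) using 2 <;> group
    | inv e he ihe =>
      intro n hn
      convert (ihe ((x⁻¹ * of e * x)⁻¹ * n) (N.mul_mem (N.inv_mem (hconj e he)) hn)).symm using 2
        <;> simp [mul_assoc]
  let good : Finset K → Prop := fun F => ∀ y ∈ Set.range r,
    (∀ e ∈ D ⊓ K, ∀ n ∈ N, S F (of e * y * n) ↔ S F (y * n)) ∧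
      ∀ e ∈ C ⊓ K, ∀ n ∈ N, S F (of e * (t⁻¹ * y) * n) ↔ S F (t⁻¹ * y * n)
  have hgood : ∀ᶠ F in atTop, good F := hrfin.eventually_all.2 fun y _ =>
    (hshiftE _ (hD _ inf_le_left) inf_le_right y).and
      (hshiftE _ (hC _ inf_le_left) inf_le_right (t⁻¹ * y))
  let σ : Finset K → G → ℤ := fun F x => if S F x then 1 else 0
  have hσ : ∀ {F x y}, (S F x ↔ S F y) → σ F x = σ F y := fun h => by simp only [σ, h]
  have hW : ∀ F, good F → ∀ y ∈ Set.range r, ∀ z, y⁻¹ * z ∈ N → ∀ e ∈ D, y⁻¹ * (of e * z) ∈ N →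
      σ F (t⁻¹ * (of e * z)) - σ F (of e * z) = σ F (t⁻¹ * z) - σ F z := by
    intro F hF y hy z hz e he hez
    have heK : e ∈ K := by
      have := hN.conj_mem _ (N.mul_mem hez (N.inv_mem hz)) y
      change of e ∈ N
      simpa [mul_assoc] using this
    obtain ⟨c, rfl⟩ : ∃ c : C, (φ c : A) = e := ⟨φ.symm ⟨e, he⟩, by simp⟩
    have hcK : (c : A) ∈ K := by
      have := hN.conj_mem' _ heK t
      rw [mul_assoc, ← t_mul_of] at this
      change of (c : A) ∈ N
      simpa using this
    have htc : t⁻¹ * (of (φ c : A) * z) = of (c : A) * (t⁻¹ * z) := by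
      rw [← mul_assoc, inv_t_mul_of, mul_assoc]
      simp
    congr 1
    · rw [htc]
      apply hσ
      simpa [mul_assoc] using (hF y hy).2 c ⟨c.2, hcK⟩ _ hz
    · apply hσ
      simpa [mul_assoc] using (hF y hy).1 _ ⟨he, heK⟩ _ hz
  have hδ : ∀ F, ∃ δ : G → G → ℤ, good F → (∀ g k x, δ (g * k) x = δ g x + δ k (g⁻¹ * x)) ∧
      (∀ a x, δ (of a) x = σ F x - σ F ((of a)⁻¹ * x)) ∧
      ∀ x, (r x)⁻¹ * x ∈ N → δ t x = 0 := by
    intro F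
    by_cases hF : good F
    · obtain ⟨δ, h1, h2, h3⟩ := exists_crossedHom_eq_zero (φ := φ) (σ F)
        (fun x => σ F (t⁻¹ * ((d x : G)⁻¹ * x)) - σ F ((d x : G)⁻¹ * x)) (by
          intro e he x
          obtain ⟨f, hf, hfd⟩ := (D.map (of : A →* G)).mul_mem
            (inv_mem (d (of e * x)).2) (mul_mem ⟨e, he, rfl⟩ (d x).2)
          have hz : (d (of e * x) : G)⁻¹ * (of e * x) = of f * ((d x : G)⁻¹ * x) := by
            rw [hfd]
            simp [mul_assoc]
          have hz' := hd (of e * x)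
          rw [hrD _ ⟨e, he, rfl⟩, hz] at hz'
          simp only [hz]
          exact hW F hF (r x) ⟨x, rfl⟩ _ (hd x) f hf hz')
      refine ⟨δ, fun _ => ⟨h1, h2, fun x hx => h3 x ?_⟩⟩
      obtain ⟨f, hf, hfd⟩ := inv_mem (d x).2
      have hz := hd x
      rw [← hfd] at hz ⊢
      exact hW F hF (r x) ⟨x, rfl⟩ x hx f hf hz
    · exact ⟨0, fun h => absurd h hF⟩
  choose δ hδ using hδ
  have hof : ∀ (a : A) (x : G), ∀ᶠ F in atTop, ∀ n ∈ N, δ F (of a) (of a * x * n) = 0 := by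
    intro a x
    filter_upwards [hgood, hshift a x] with F hF hS n hn
    rw [(hδ F hF).2.1, sub_eq_zero]
    apply hσ
    simpa [mul_assoc] using hS n hn
  have hclaim : ∀ g x : G, ∀ᶠ F in atTop, ∀ n ∈ N, δ F g (g * x * n) = 0 := by
    intro g
    induction g using induction_on with
    | of a => exact hof a
    | t =>
      intro x
      obtain ⟨e, he, hed⟩ := (d (t * x)).2
      let c := φ.symm ⟨e, he⟩
      have hc : (of (c : A) : G) = t⁻¹ * of e * t := equiv_symm_eq_conj ⟨e, he⟩
      have htc : (t : G) = of e * (t * of (c : A)⁻¹) := by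
        rw [map_inv, hc]
        simp [mul_assoc]
      filter_upwards [hgood, hof e ((of e)⁻¹ * (t * x)), hof (c : A)⁻¹ x] with F hF hFe hFc n hn
      obtain ⟨hδ1, -, hδ3⟩ := hδ F hF
      have h1 : δ F (of e) (t * x * n) = 0 := by simpa [mul_assoc] using hFe n hn
      have h2 : δ F t ((of e)⁻¹ * (t * x * n)) = 0 := by
        apply hδ3
        rw [hrD _ (inv_mem ⟨e, he, rfl⟩), hrN n hn]
        have := N.mul_mem (hd (t * x)) hn
        rw [← hed] at this
        simpa [mul_assoc] using this
      have h3 : δ F (of (c : A)⁻¹) (t⁻¹ * ((of e)⁻¹ * (t * x * n))) = 0 := by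
        have := hFc n hn
        rw [map_inv, hc] at this ⊢
        simpa [mul_assoc] using this
      nth_rewrite 1 [htc]
      rw [hδ1, hδ1, h1, h2, h3, add_zero, add_zero]
    | mul g k hg hk =>
      intro x
      filter_upwards [hgood, hg (k * x), hk x] with F hF hFg hFk n hn
      have h1 := hFg n hn
      have h2 := hFk n hn
      rw [(hδ F hF).1]
      simp only [mul_assoc, inv_mul_cancel_left] at h1 h2 ⊢
      rw [h1, h2, add_zero]
    | inv g hg =>
      intro x
      filter_upwards [hgood, hg (g⁻¹ * x)] with F hF hFg n hn
      obtain ⟨hδ1, hδ2, -⟩ := hδ F hF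
      have h1 := hδ1 g g⁻¹ (x * n)
      have h2 := hδ2 1 (x * n)
      have h3 := hFg n hn
      simp only [mul_assoc, mul_inv_cancel, map_one, inv_one, one_mul, sub_self,
        mul_inv_cancel_left] at h1 h2 h3 ⊢
      rwa [h2, h3, zero_add, eq_comm] at h1
  obtain ⟨T, hT⟩ := hfg
  obtain ⟨F, hF, hFs, hFT⟩ := (hgood.and ((hB (s 1) (by simpa using hsK 1)).and
    ((Finset.eventually_all T).2 fun g _ => hclaim g 1))).exists
  obtain ⟨hδ1, hδ2, hδ3⟩ := hδ F hF
  have hall : ∀ n ∈ N, ∀ m ∈ N, δ F n m = 0 := by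
    intro n hn
    rw [← hT] at hn
    induction hn using Subgroup.closure_induction with
    | mem g hg =>
      intro m hm
      have hgN : g ∈ N := hT ▸ Subgroup.subset_closure hg
      simpa using hFT g hg (g⁻¹ * m) (N.mul_mem (N.inv_mem hgN) hm)
    | one =>
      intro m hm
      simpa using hδ2 1 m
    | mul g k hg hk ihg ihk =>
      intro m hm
      rw [hT] at hg
      rw [hδ1, ihg m hm, ihk _ (N.mul_mem (N.inv_mem hg) hm), add_zero]
    | inv g hg ihg =>
      intro m hm
      rw [hT] at hg
      have h1 := hδ1 g g⁻¹ (g * m)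
      have h2 := hδ2 1 (g * m)
      rw [map_one, inv_one, one_mul, sub_self] at h2
      rwa [mul_inv_cancel, inv_mul_cancel_left, ihg _ (N.mul_mem hg hm), zero_add, h2,
        eq_comm] at h1
  refine ⟨F.image (↑), le_antisymm ?_ fun k hk => ?_⟩
  · rw [Subgroup.closure_le]
    intro k hk
    obtain ⟨k, -, rfl⟩ := Finset.mem_image.1 hk
    exact k.2
  · have h := hall (of k) hk (of k) hk
    rw [hδ2, inv_mul_cancel, sub_eq_zero] at h
    have hSk : S F (of k) ↔ S F 1 := by
      simp only [σ] at h
      split_ifs at h <;> simp_all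
    have hk1 : (1 : A)⁻¹ * k ∈ K := by
      rw [inv_one, one_mul]
      exact hk
    rw [← map_one (of : A →* G), hS, hS, ← hs 1 k hk1, mul_one] at hSk
    have := (B F).mul_mem hFs (hSk.2 (inv_mem hFs))
    rw [Finset.coe_image]
    simpa using this

/-- A normal subgroup of finite index in the base group and with finitely many orbits of edges on
the Bass–Serre tree has finite index. -/
theorem finite_quotient_of_comap {N : Subgroup (HNNExtension A C D φ)} [hN : N.Normal]
    [(D.map (of : A →* HNNExtension A C D φ) ⊔ N).FiniteIndex]
    [(N.comap (of : A →* HNNExtension A C D φ)).FiniteIndex] :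
    Finite (HNNExtension A C D φ ⧸ N) := by
  have h1 : N.relIndex (D.map (of : A →* HNNExtension A C D φ)) ≠ 0 := by
    have : N.relIndex (of : A →* HNNExtension A C D φ).range ≠ 0 := by
      rw [← Subgroup.index_comap]
      exact Subgroup.FiniteIndex.index_ne_zero
    exact fun h => this (Subgroup.relIndex_eq_zero_of_le_right (Subgroup.map_le_range _ _) h)
  have h2 : N.index ≠ 0 := by
    rw [← Subgroup.relIndex_mul_index (le_sup_right : N ≤ D.map of ⊔ N),
      Subgroup.relIndex_sup_right]
    exact mul_ne_zero h1 Subgroup.FiniteIndex.index_ne_zero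
  have : N.FiniteIndex := ⟨h2⟩
  infer_instance

end HNNExtension


/-- Moon's theorem, HNN case.  Let `G = A∗_C` be an HNN extension with base
group `A` and associated subgroups `C` and `D`, where `C` is free abelian of finite rank.
Suppose `A` contains no finitely generated nontrivial normal subgroup of infinite index.
If `N` is a finitely generated normal subgroup of `G` not contained in `C`, then either `G/N`
is finite or `N` is a free group. -/
theorem stmt_8 {A : Type*} [Group A] (C D : Subgroup A) (φ : C ≃* D)
    (hCfree : ∃ n : ℕ, Nonempty (C ≃* Multiplicative (Fin n → ℤ)))
    (hA : ∀ K : Subgroup A, K.Normal → K.FG → K ≠ ⊥ → K.FiniteIndex)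
    (N : Subgroup (HNNExtension A C D φ)) (hNnorm : N.Normal) (hNfg : N.FG)
    (hNC : ¬ N ≤ Subgroup.map (HNNExtension.of : A →* HNNExtension A C D φ) C) :
    Finite (HNNExtension A C D φ ⧸ N) ∨ IsFreeGroup N := by
  obtain ⟨n, ⟨e⟩⟩ := hCfree
  by_cases hK : N.comap (HNNExtension.of : A →* HNNExtension A C D φ) = ⊥
  · exact Or.inr (HNNExtension.isFreeGroup_of_comap_eq_bot N hK)
  left
  have := HNNExtension.finiteIndex_map_of_sup_of_fg N hNfg hNC
  have hKfg := HNNExtension.comap_of_fg N hNfg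
    (fun E hE => Subgroup.fg_of_mulEquiv_pi_int e hE)
    (fun E hE => Subgroup.fg_of_mulEquiv_pi_int (φ.symm.trans e) hE)
  have := hA _ inferInstance hKfg hK
  exact HNNExtension.finite_quotient_of_comap
end
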